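/- arXiv:0709.0517 — 3 statements merged into one kernel-verified Lean document; each statement's English description precedes it below -/
import Mathlib

section
/- There exist absolute constants c > 0 and C > 0 and, for each δ ∈ (0, c), a threshold N(δ) such that the following holds for n ≥ N(δ). Suppose |T| ≤ |Ω| = δn (with δn an integer), and let T and Ω be independent uniformly random subsets of {1,…,n} of fixed cardinalities |T| and |Ω| respectively. Then P( √(n/|Ω|) · ‖F_{ΩT}‖ ≥ 9 ) ≤ n^{−C}. -/
/-- The spectral norm (ℓ2 → ℓ2 operator norm) of a complex matrix. -/
noncomputable def specNorm {α β : Type*} [Fintype α] [Fintype β] [DecidableEq β]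
    (A : Matrix α β ℂ) : ℝ :=
  ‖LinearMap.toContinuousLinearMap (Matrix.toEuclideanLin A)‖

/-- The `n × n` discrete Fourier transform matrix, with entries
`F (j, t) = n^{-1/2} e^{2πi j t / n}` for `j, t = 1, …, n` (indices coded by `Fin n` via
`j ↦ j.val + 1`). -/
noncomputable def dftMatrix (n : ℕ) : Matrix (Fin n) (Fin n) ℂ := fun j t =>
  (1 / (Real.sqrt n : ℂ)) *
    Complex.exp (2 * Real.pi * Complex.I * (((j : ℕ) : ℂ) + 1) * (((t : ℕ) : ℂ) + 1) / (n : ℂ))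

/-- The submatrix `F_{ΩT}` of the DFT matrix with rows indexed by `Ω` and columns by `T`. -/
noncomputable def dftSub (n : ℕ) (Ω T : Finset (Fin n)) : Matrix Ω T ℂ :=
  (dftMatrix n).submatrix (fun ω => (ω : Fin n)) (fun t => (t : Fin n))

attribute [local instance] Classical.propDecidable

/-- The probability that a uniformly random subset `Ω ⊆ {1,…,n}` of fixed cardinality `m`
satisfies the predicate `p`: the number of subsets of cardinality `m` satisfying `p`, divided
by the total number of subsets of cardinality `m`. -/
noncomputable def uniformSetProb (n m : ℕ) (p : Finset (Fin n) → Prop) : ℝ :=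
  (((Finset.powersetCard m (Finset.univ : Finset (Fin n))).filter p).card : ℝ) /
    ((Finset.powersetCard m (Finset.univ : Finset (Fin n))).card : ℝ)

/-- The probability that a pair of independent uniformly random subsets `T, Ω ⊆ {1,…,n}` of
fixed cardinalities `mT` and `mΩ` satisfies the predicate `p`. -/
noncomputable def uniformPairProb (n mT mΩ : ℕ)
    (p : Finset (Fin n) → Finset (Fin n) → Prop) : ℝ :=
  ((((Finset.powersetCard mT (Finset.univ : Finset (Fin n))) ×ˢ
      (Finset.powersetCard mΩ (Finset.univ : Finset (Fin n)))).filter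
        fun q => p q.1 q.2).card : ℝ) /
    (((Finset.powersetCard mT (Finset.univ : Finset (Fin n))).card *
      (Finset.powersetCard mΩ (Finset.univ : Finset (Fin n))).card : ℕ) : ℝ)

open scoped Nat Matrix Polynomial ComplexOrder

section Interpolation

lemma prod_abs_sub_erase (N j : ℕ) (hj : j ≤ N) :
    ∏ i ∈ (Finset.range (N + 1)).erase j, |(j : ℝ) - i| = (j ! : ℝ) * ((N - j)! : ℝ) := by
  have hlow : ∏ i ∈ Finset.range j, |(j : ℝ) - i| = (j ! : ℝ) := by
    rw [← Finset.prod_range_reflect, ← Finset.prod_range_add_one_eq_factorial]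
    push_cast
    refine Finset.prod_congr rfl fun i hi => ?_
    have hi' : i < j := Finset.mem_range.mp hi
    have : ((j - 1 - i : ℕ) : ℝ) = j - 1 - i := by
      rw [Nat.sub_sub, Nat.cast_sub (by omega)]; push_cast; ring
    rw [this, abs_of_nonneg] <;> [ring; (ring_nf; positivity)]
  have hhigh : ∏ i ∈ Finset.Ico (j + 1) (N + 1), |(j : ℝ) - i| = ((N - j)! : ℝ) := by
    rw [Finset.prod_Ico_eq_prod_range, ← Finset.prod_range_add_one_eq_factorial]
    push_cast
    refine Finset.prod_congr rfl fun i _ => ?_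
    rw [abs_sub_comm, abs_of_nonneg] <;> [ring; (ring_nf; positivity)]
  have hset : (Finset.range (N + 1)).erase j = Finset.range j ∪ Finset.Ico (j + 1) (N + 1) := by
    ext i
    simp only [Finset.mem_erase, Finset.mem_range, Finset.mem_union, Finset.mem_Ico]
    omega
  rw [hset, Finset.prod_union, hlow, hhigh]
  rw [Finset.disjoint_left]
  intro i h1 h2
  simp only [Finset.mem_range, Finset.mem_Ico] at h1 h2
  omega

/-- A real polynomial of degree at most `N` which is bounded by `B` on `[1/2, 1]` is bounded by
`B * 11 ^ N` on `[0, 1]`. -/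
lemma abs_eval_le_of_abs_eval_le_Icc_half {N : ℕ} (r : ℝ[X]) (hdeg : r.natDegree ≤ N)
    {B : ℝ} (hB : ∀ x ∈ Set.Icc (1 / 2 : ℝ) 1, |r.eval x| ≤ B) {s : ℝ}
    (hs : s ∈ Set.Icc (0 : ℝ) 1) : |r.eval s| ≤ B * 11 ^ N := by
  have hB0 : 0 ≤ B := (abs_nonneg _).trans (hB 1 (by norm_num))
  rcases Nat.eq_zero_or_pos N with rfl | hN
  · obtain ⟨a, rfl⟩ := Polynomial.natDegree_eq_zero.mp (Nat.le_zero.mp hdeg)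
    simpa using hB 1 (by norm_num)
  have hN' : (0 : ℝ) < N := by exact_mod_cast hN
  set v : ℕ → ℝ := fun j => (N + j) / (2 * N) with hv
  have hvs : Set.InjOn v (Finset.range (N + 1)) := by
    intro a _ b _ hab
    simp only [hv] at hab
    field_simp at hab
    exact_mod_cast add_left_cancel hab
  have hvI : ∀ j ∈ Finset.range (N + 1), v j ∈ Set.Icc (1 / 2 : ℝ) 1 := by
    intro j hj
    have hj' : (j : ℝ) ≤ N := by exact_mod_cast Nat.lt_succ_iff.mp (Finset.mem_range.mp hj)
    have hj0 : (0 : ℝ) ≤ j := j.cast_nonneg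
    simp only [hv]
    constructor
    · rw [div_le_div_iff₀ (by norm_num) (by positivity)]; nlinarith
    · rw [div_le_one (by positivity)]; linarith
  have hdlt : r.degree < ((Finset.range (N + 1)).card : ℕ) := by
    rw [Finset.card_range]
    exact (Polynomial.degree_le_of_natDegree_le hdeg).trans_lt (by exact_mod_cast Nat.lt_succ_self N)
  have hr := Lagrange.eq_interpolate hvs hdlt
  rw [hr, Lagrange.interpolate_apply, Polynomial.eval_finsetSum]
  have hterm : ∀ j ∈ Finset.range (N + 1),
      |(Polynomial.C (r.eval (v j)) * Lagrange.basis (Finset.range (N + 1)) v j).eval s| ≤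
        B * ((2 * N) ^ N / N ! * (N.choose j : ℝ)) := by
    intro j hj
    have hjN : j ≤ N := Nat.lt_succ_iff.mp (Finset.mem_range.mp hj)
    rw [Polynomial.eval_mul, Polynomial.eval_C, abs_mul]
    refine mul_le_mul (hB _ (hvI j hj)) ?_ (abs_nonneg _) hB0
    rw [Lagrange.basis, Polynomial.eval_prod, Finset.abs_prod]
    have hcard : ((Finset.range (N + 1)).erase j).card = N := by
      rw [Finset.card_erase_of_mem hj, Finset.card_range]; rfl
    calc ∏ i ∈ (Finset.range (N + 1)).erase j, |(Lagrange.basisDivisor (v j) (v i)).eval s|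
        ≤ ∏ i ∈ (Finset.range (N + 1)).erase j, (2 * N) * |(j : ℝ) - i|⁻¹ := by
          refine Finset.prod_le_prod (fun _ _ => abs_nonneg _) fun i hi => ?_
          have hi' := Finset.mem_of_mem_erase hi
          have h1 := hvI i hi'
          simp only [Lagrange.basisDivisor, Polynomial.eval_mul, Polynomial.eval_C,
            Polynomial.eval_sub, Polynomial.eval_X, abs_mul, abs_inv]
          have h2 : |s - v i| ≤ 1 := by
            rw [abs_le]; constructor <;> linarith [h1.1, h1.2, hs.1, hs.2]
          have h3 : |v j - v i| = |(j : ℝ) - i| / (2 * N) := by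
            have : v j - v i = ((j : ℝ) - i) / (2 * N) := by simp only [hv]; field_simp; ring
            rw [this, abs_div, abs_of_pos (a := (2 * N : ℝ)) (by positivity)]
          rw [h3, inv_div, div_eq_mul_inv]
          exact mul_le_of_le_one_right (by positivity) h2
      _ = (2 * N) ^ N / N ! * (N.choose j : ℝ) := by
          rw [Finset.prod_mul_distrib, Finset.prod_const, hcard, Finset.prod_inv_distrib,
            prod_abs_sub_erase N j hjN, Nat.cast_choose ℝ hjN]
          have := N.factorial_ne_zero
          field_simp
  have hfac : (N : ℝ) ^ N / N ! ≤ Real.exp 1 ^ N := by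
    rw [← Real.exp_nat_mul, mul_one]
    exact Real.pow_div_factorial_le_exp _ hN'.le N
  have hexp : Real.exp 1 ≤ 11 / 4 := by linarith [Real.exp_one_lt_d9]
  calc _ ≤ ∑ j ∈ Finset.range (N + 1), B * ((2 * N) ^ N / N ! * (N.choose j : ℝ)) :=
        (Finset.abs_sum_le_sum_abs _ _).trans (Finset.sum_le_sum hterm)
    _ = B * (4 ^ N * ((N : ℝ) ^ N / N !)) := by
        rw [← Finset.mul_sum, ← Finset.mul_sum]
        have : ∑ j ∈ Finset.range (N + 1), (N.choose j : ℝ) = 2 ^ N := by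
          exact_mod_cast Nat.sum_range_choose N
        rw [this, show (4 : ℝ) = 2 * 2 by norm_num, mul_pow, mul_pow]
        ring
    _ ≤ B * (4 ^ N * (11 / 4) ^ N) := by
        gcongr
        exact hfac.trans (pow_le_pow_left₀ (Real.exp_pos 1).le hexp N)
    _ = B * 11 ^ N := by rw [← mul_pow]; norm_num

end Interpolation

section Bernoulli

variable {α : Type*} [Fintype α]

/-- The probability of the outcome `S` when each element of `α` is selected independently with
probability `y`. -/
noncomputable def bernoulliWeight (y : ℝ) (S : Finset α) : ℝ :=
  y ^ S.card * (1 - y) ^ (Fintype.card α - S.card)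

lemma bernoulliWeight_nonneg {y : ℝ} (h0 : 0 ≤ y) (h1 : y ≤ 1) (S : Finset α) :
    0 ≤ bernoulliWeight y S :=
  mul_nonneg (pow_nonneg h0 _) (pow_nonneg (sub_nonneg.mpr h1) _)

lemma sum_bernoulliWeight_of_subset (y : ℝ) (A : Finset α) :
    ∑ S : Finset α, (if A ⊆ S then bernoulliWeight y S else 0) = y ^ A.card := by
  have h := Finset.prod_add (fun _ : α => y) (fun i => if i ∈ A then 0 else 1 - y) Finset.univ
  rw [Finset.powerset_univ] at h
  have hl : ∏ i : α, (y + if i ∈ A then 0 else 1 - y) = y ^ A.card := by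
    have : ∀ i, (y + if i ∈ A then 0 else 1 - y) = if i ∈ A then y else 1 := fun i => by
      split_ifs <;> ring
    simp_rw [this, Finset.prod_ite_mem, Finset.univ_inter, Finset.prod_const]
  rw [← hl, h]
  refine Finset.sum_congr rfl fun S _ => ?_
  rw [Finset.prod_const]
  split_ifs with hA
  · have : ∏ i ∈ Finset.univ \ S, (if i ∈ A then 0 else 1 - y) =
        (1 - y) ^ (Fintype.card α - S.card) := by
      rw [← Finset.card_univ, ← Finset.card_sdiff_of_subset (Finset.subset_univ S),
        ← Finset.prod_const]
      exact Finset.prod_congr rfl fun i hi =>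
        if_neg fun hiA => (Finset.mem_sdiff.mp hi).2 (hA hiA)
    rw [this, bernoulliWeight]
  · obtain ⟨i, hiA, hiS⟩ := Finset.not_subset.mp hA
    have : ∏ i ∈ Finset.univ \ S, (if i ∈ A then 0 else 1 - y) = 0 :=
      Finset.prod_eq_zero (i := i) (by simp [hiS]) (by simp [hiA])
    rw [this, mul_zero]

lemma sum_bernoulliWeight (y : ℝ) : ∑ S : Finset α, bernoulliWeight y S = 1 := by
  simpa using sum_bernoulliWeight_of_subset y (∅ : Finset α)

end Bernoulli

lemma Nat.factorial_mul_pow_le_factorial_mul_pow (m j : ℕ) : m ! * m ^ j ≤ j ! * m ^ m := by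
  rcases le_total m j with h | h
  · have := Nat.factorial_mul_pow_sub_le_factorial h
    calc m ! * m ^ j = m ! * m ^ (j - m) * m ^ m := by rw [mul_assoc, ← pow_add, Nat.sub_add_cancel h]
      _ ≤ j ! * m ^ m := Nat.mul_le_mul_right _ this
  · calc m ! * m ^ j = j ! * m.descFactorial (m - j) * m ^ j := by
          rw [← Nat.factorial_mul_descFactorial (Nat.sub_le m j), Nat.sub_sub_self h]
      _ ≤ j ! * m ^ (m - j) * m ^ j := by gcongr; exact Nat.descFactorial_le_pow _ _
      _ = j ! * m ^ m := by rw [mul_assoc, ← pow_add, Nat.sub_add_cancel h]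

/-- The number `m` is a mode of the binomial distribution with parameters `n` and `m / n`. -/
lemma one_le_succ_mul_choose_mul_bernoulli {n m : ℕ} (hn : 0 < n) (hm : m ≤ n) :
    (1 : ℝ) ≤ (n + 1) * (n.choose m * (((m : ℝ) / n) ^ m * (1 - (m : ℝ) / n) ^ (n - m))) := by
  have hn' : (0 : ℝ) < n := by exact_mod_cast hn
  have hmode : ∀ j ∈ Finset.range (n + 1), n.choose j * (m ^ j * (n - m) ^ (n - j)) ≤
      n.choose m * (m ^ m * (n - m) ^ (n - m)) := by
    intro j hj
    have hj' : j ≤ n := Nat.lt_succ_iff.mp (Finset.mem_range.mp hj)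
    have h1 := Nat.factorial_mul_pow_le_factorial_mul_pow m j
    have h2 := Nat.factorial_mul_pow_le_factorial_mul_pow (n - m) (n - j)
    have hpos : 0 < j ! * (n - j)! * (m ! * (n - m)!) := by positivity
    refine le_of_mul_le_mul_left ?_ hpos
    calc j ! * (n - j)! * (m ! * (n - m)!) * (n.choose j * (m ^ j * (n - m) ^ (n - j)))
        = (n.choose j * j ! * (n - j)!) * ((m ! * m ^ j) * ((n - m)! * (n - m) ^ (n - j))) := by
          ring
      _ ≤ n ! * ((j ! * m ^ m) * ((n - j)! * (n - m) ^ (n - m))) := by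
          rw [Nat.choose_mul_factorial_mul_factorial hj']
          exact Nat.mul_le_mul_left _ (Nat.mul_le_mul h1 h2)
      _ = j ! * (n - j)! * (m ! * (n - m)!) * (n.choose m * (m ^ m * (n - m) ^ (n - m))) := by
          rw [← Nat.choose_mul_factorial_mul_factorial hm]; ring
  have hsum : n ^ n ≤ (n + 1) * (n.choose m * (m ^ m * (n - m) ^ (n - m))) := by
    have h := add_pow m (n - m) n
    rw [Nat.add_sub_cancel' hm] at h
    calc n ^ n = ∑ j ∈ Finset.range (n + 1), n.choose j * (m ^ j * (n - m) ^ (n - j)) := by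
          rw [h]; exact Finset.sum_congr rfl fun j _ => by simp; ring
      _ ≤ _ := by simpa using Finset.sum_le_sum hmode
  have hcast : (n : ℝ) ^ n ≤ (n + 1) * (n.choose m * ((m : ℝ) ^ m * ((n : ℝ) - m) ^ (n - m))) := by
    rw [← Nat.cast_sub hm]; exact_mod_cast hsum
  have h3 : (1 - (m : ℝ) / n) = ((n : ℝ) - m) / n := by field_simp
  rw [h3, div_pow, div_pow, div_mul_div_comm, ← pow_add, Nat.add_sub_cancel' hm, ← mul_div_assoc,
    ← mul_div_assoc, le_div_iff₀ (by positivity), one_mul]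
  exact hcast

section Trace

variable {ι : Type*}

/-- The diagonal projection onto the coordinates in `S`. -/
noncomputable def coordProj (S : Finset ι) : Matrix ι ι ℂ :=
  Matrix.diagonal fun i => if i ∈ S then 1 else 0

lemma coordProj_conjTranspose (S : Finset ι) : (coordProj S)ᴴ = coordProj S := by
  rw [coordProj, Matrix.diagonal_conjTranspose]
  congr 1
  ext i
  simp only [Pi.star_apply]
  split_ifs <;> simp

variable [Fintype ι]

lemma coordProj_mul_self (S : Finset ι) : coordProj S * coordProj S = coordProj S := by
  rw [coordProj, Matrix.diagonal_mul_diagonal]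
  congr 1
  ext i
  split_ifs <;> simp

open scoped Matrix.Norms.L2Operator

lemma norm_coordProj_le (S : Finset ι) : ‖coordProj S‖ ≤ 1 := by
  rw [coordProj, Matrix.l2_opNorm_diagonal, pi_norm_le_iff_of_nonneg zero_le_one]
  intro i
  split_ifs <;> simp

/-- The rows outside `S` and the columns outside `T` of `F` are replaced by zero. -/
noncomputable def compress (F : Matrix ι ι ℂ) (S T : Finset ι) : Matrix ι ι ℂ :=
  coordProj S * F * coordProj T

lemma compress_apply_of_mem (F : Matrix ι ι ℂ) {S T : Finset ι} {i j : ι} (hi : i ∈ S)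
    (hj : j ∈ T) : compress F S T i j = F i j := by
  simp [compress, coordProj, Matrix.diagonal_mul, Matrix.mul_diagonal, hi, hj]

lemma norm_compress_le {F : Matrix ι ι ℂ} (hF : ‖F‖ ≤ 1) (S T : Finset ι) :
    ‖compress F S T‖ ≤ 1 := by
  calc ‖compress F S T‖ ≤ ‖coordProj S‖ * ‖F‖ * ‖coordProj T‖ :=
        (norm_mul_le _ _).trans (by gcongr; exact norm_mul_le _ _)
    _ ≤ 1 * 1 * 1 := by gcongr <;> exact norm_coordProj_le _
    _ = 1 := by norm_num

lemma specNorm_submatrix_le (A : Matrix ι ι ℂ) (S T : Finset ι) :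
    specNorm (A.submatrix (fun i : S => (i : ι)) (fun j : T => (j : ι))) ≤ ‖A‖ := by
  refine ContinuousLinearMap.opNorm_le_bound _ (norm_nonneg _) fun x => ?_
  set y : EuclideanSpace ℂ ι := WithLp.toLp 2 fun j => if h : j ∈ T then x ⟨j, h⟩ else 0 with hy
  have hyT : ∀ j : T, y j = x j := fun j => by simp [hy]
  have hyT' : ∀ j ∉ T, y j = 0 := fun j hj => by simp [hy, hj]
  have hyx : ‖y‖ = ‖x‖ := by
    rw [EuclideanSpace.norm_eq, EuclideanSpace.norm_eq]
    congr 1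
    rw [← Finset.sum_subset (Finset.subset_univ T) fun j _ hj => by simp [hyT' j hj],
      ← Finset.sum_coe_sort T]
    exact Finset.sum_congr rfl fun j _ => by rw [hyT]
  rw [← hyx]
  refine le_trans ?_ (Matrix.l2_opNorm_mulVec A y)
  rw [EuclideanSpace.norm_eq, EuclideanSpace.norm_eq]
  refine Real.sqrt_le_sqrt ?_
  refine le_trans (le_of_eq ?_) (Finset.sum_le_sum_of_subset_of_nonneg (Finset.subset_univ S)
    fun i _ _ => sq_nonneg _)
  rw [← Finset.sum_coe_sort S]
  refine Finset.sum_congr rfl fun i _ => ?_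
  congr 2
  change ∑ j : T, A i j * x j = ∑ j, A i j * y j
  rw [← Finset.sum_subset (Finset.subset_univ T) fun j _ hj => by simp [hyT' j hj],
    ← Finset.sum_coe_sort T]
  exact Finset.sum_congr rfl fun j _ => by rw [hyT]

lemma trace_pow_eq_sum_eigenvalues {B : Matrix ι ι ℂ} (hB : B.IsHermitian) (k : ℕ) :
    (B ^ k).trace = ∑ i, (hB.eigenvalues i : ℂ) ^ k := by
  conv_lhs => rw [hB.spectral_theorem, ← map_pow, Unitary.conjStarAlgAut_apply,
    Matrix.trace_mul_cycle, Matrix.diagonal_pow]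
  simp [Matrix.trace_diagonal]

lemma norm_eq_norm_eigenvalues {B : Matrix ι ι ℂ} (hB : B.IsHermitian) :
    ‖B‖ = ‖hB.eigenvalues‖ := by
  conv_lhs => rw [hB.spectral_theorem, Unitary.conjStarAlgAut_apply]
  rw [← Unitary.coe_star, CStarRing.norm_mul_coe_unitary, CStarRing.norm_coe_unitary_mul,
    Matrix.l2_opNorm_diagonal]
  simp [Pi.norm_def]

lemma norm_pow_le_re_trace_pow {B : Matrix ι ι ℂ} (hB : B.PosSemidef) [Nonempty ι] (k : ℕ) :
    ‖B‖ ^ k ≤ (B ^ k).trace.re := by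
  obtain ⟨i, _, hi⟩ := Finset.exists_mem_eq_sup Finset.univ Finset.univ_nonempty
    fun i => ‖hB.1.eigenvalues i‖₊
  have hnorm : ‖B‖ = hB.1.eigenvalues i := by
    rw [norm_eq_norm_eigenvalues hB.1, Pi.norm_def, hi, coe_nnnorm, Real.norm_eq_abs,
      abs_of_nonneg (hB.eigenvalues_nonneg i)]
  rw [trace_pow_eq_sum_eigenvalues hB.1, hnorm]
  exact_mod_cast Finset.single_le_sum (f := fun i => hB.1.eigenvalues i ^ k)
    (fun i _ => pow_nonneg (hB.eigenvalues_nonneg i) k) (Finset.mem_univ i)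

lemma re_trace_pow_nonneg {B : Matrix ι ι ℂ} (hB : B.PosSemidef) (k : ℕ) :
    0 ≤ (B ^ k).trace.re := by
  rw [trace_pow_eq_sum_eigenvalues hB.1]
  exact_mod_cast Finset.sum_nonneg fun i _ => pow_nonneg (hB.eigenvalues_nonneg i) k

lemma re_trace_pow_le_card {B : Matrix ι ι ℂ} (hB : B.PosSemidef) (hB1 : ‖B‖ ≤ 1) (k : ℕ) :
    (B ^ k).trace.re ≤ Fintype.card ι := by
  have hle : ∀ i, hB.1.eigenvalues i ^ k ≤ 1 := fun i => by
    refine pow_le_one₀ (hB.eigenvalues_nonneg i) ?_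
    rw [norm_eq_norm_eigenvalues hB.1] at hB1
    exact (le_abs_self _).trans ((norm_le_pi_norm _ i).trans hB1)
  have hsum : ∑ i, hB.1.eigenvalues i ^ k ≤ Fintype.card ι := by
    simpa using Finset.sum_le_sum fun i (_ : i ∈ Finset.univ) => hle i
  rw [trace_pow_eq_sum_eigenvalues hB.1]
  exact_mod_cast hsum

/-- The rank-one matrix contributed to `P_S * F * P_T * Fᴴ` by the row `a.1` and the column
`a.2`. -/
noncomputable def rankOneTerm (F : Matrix ι ι ℂ) (a : ι × ι) : Matrix ι ι ℂ :=
  fun i j => if i = a.1 then F a.1 a.2 * star (F j a.2) else 0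

/-- The contribution of a closed walk to the trace of a power of `P_S * F * P_T * Fᴴ`. -/
noncomputable def walkWeight (F : Matrix ι ι ℂ) {k : ℕ} (f : Fin k → ι × ι) : ℂ :=
  (List.ofFn fun l => rankOneTerm F (f l)).prod.trace

lemma coordProj_mul_mul_eq_sum (F : Matrix ι ι ℂ) (S T : Finset ι) :
    coordProj S * (F * coordProj T * Fᴴ) =
      ∑ a : ι × ι, (if a.1 ∈ S ∧ a.2 ∈ T then (1 : ℂ) else 0) • rankOneTerm F a := by
  ext i j
  rw [Matrix.sum_apply, Fintype.sum_prod_type, Finset.sum_eq_single i]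
  · rw [coordProj, Matrix.diagonal_mul, Matrix.mul_apply]
    simp only [coordProj, Matrix.mul_diagonal, Matrix.conjTranspose_apply,
      Matrix.smul_apply, rankOneTerm, smul_eq_mul, Finset.mul_sum]
    refine Finset.sum_congr rfl fun t _ => ?_
    by_cases hi : i ∈ S <;> by_cases ht : t ∈ T <;> simp [hi, ht]
  · intro b _ hb
    exact Finset.sum_eq_zero fun t _ => by simp [rankOneTerm, Ne.symm hb]
  · simp

lemma trace_pow_eq_sum_walkWeight (F : Matrix ι ι ℂ) (S T : Finset ι) (k : ℕ) :
    ((coordProj S * (F * coordProj T * Fᴴ)) ^ k).trace =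
      ∑ f : Fin k → ι × ι,
        if (∀ l, (f l).1 ∈ S) ∧ ∀ l, (f l).2 ∈ T then walkWeight F f else 0 := by
  rw [coordProj_mul_mul_eq_sum, ← MultilinearMap.mkPiAlgebraFin_apply_const (R := ℂ),
    MultilinearMap.map_sum, Matrix.trace_sum]
  refine Finset.sum_congr rfl fun f _ => ?_
  rw [MultilinearMap.map_smul_univ, Matrix.trace_smul, MultilinearMap.mkPiAlgebraFin_apply,
    ← walkWeight, Finset.prod_ite_zero]
  simp [forall_and]

lemma compress_mul_conjTranspose_eq (F : Matrix ι ι ℂ) (S T : Finset ι) :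
    compress F S T * (compress F S T)ᴴ =
      coordProj S * (F * coordProj T * Fᴴ) * coordProj S := by
  simp only [compress, Matrix.conjTranspose_mul, coordProj_conjTranspose, Matrix.mul_assoc]
  rw [← Matrix.mul_assoc (coordProj T) (coordProj T), coordProj_mul_self]

lemma trace_compress_mul_conjTranspose_pow (F : Matrix ι ι ℂ) (S T : Finset ι) (k : ℕ) :
    ((compress F S T * (compress F S T)ᴴ) ^ (k + 1)).trace =
      ((coordProj S * (F * coordProj T * Fᴴ)) ^ (k + 1)).trace := by
  rw [compress_mul_conjTranspose_eq]
  set P := coordProj S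
  set G := F * coordProj T * Fᴴ
  have hP : P * P = P := coordProj_mul_self S
  have h : ∀ k, (P * G * P) ^ (k + 1) = (P * G) ^ (k + 1) * P := fun k => by
    induction k with
    | zero => simp
    | succ k ih =>
      rw [pow_succ, ih, pow_succ (P * G) (k + 1)]
      simp only [Matrix.mul_assoc]
      rw [← Matrix.mul_assoc P P, hP]
  rw [h, Matrix.trace_mul_comm, pow_succ', ← Matrix.mul_assoc, ← Matrix.mul_assoc, hP]

lemma norm_rankOneTerm_mul_apply_le {F : Matrix ι ι ℂ} {b : ℝ} (hb : ∀ i j, ‖F i j‖ ≤ b)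
    (a : ι × ι) (Q : Matrix ι ι ℂ) (i j : ι) :
    ‖(rankOneTerm F a * Q) i j‖ ≤ if i = a.1 then b ^ 2 * ∑ i', ‖Q i' j‖ else 0 := by
  rw [Matrix.mul_apply]
  split_ifs with h
  · rw [Finset.mul_sum]
    refine (norm_sum_le _ _).trans (Finset.sum_le_sum fun i' _ => ?_)
    rw [norm_mul, rankOneTerm, if_pos h, norm_mul, norm_star, sq]
    have hb0 : 0 ≤ b := (norm_nonneg _).trans (hb i i)
    gcongr <;> exact hb _ _
  · simp [rankOneTerm, h]

lemma sum_norm_list_prod_rankOneTerm_le {F : Matrix ι ι ℂ} {b : ℝ} (hb : ∀ i j, ‖F i j‖ ≤ b)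
    (l : List (ι × ι)) (j : ι) :
    ∑ i, ‖(l.map (rankOneTerm F)).prod i j‖ ≤ (b ^ 2) ^ l.length := by
  induction l with
  | nil =>
    rw [Finset.sum_eq_single j (fun i _ hi => by simp [hi]) (by simp)]
    simp
  | cons a l ih =>
    rw [List.map_cons, List.prod_cons, List.length_cons, pow_succ']
    refine (Finset.sum_le_sum fun i _ => norm_rankOneTerm_mul_apply_le hb a _ i j).trans ?_
    rw [Finset.sum_ite_eq' Finset.univ a.1, if_pos (Finset.mem_univ _)]
    gcongr

lemma norm_walkWeight_le {F : Matrix ι ι ℂ} {b : ℝ} (hb : ∀ i j, ‖F i j‖ ≤ b) {k : ℕ}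
    (f : Fin (k + 1) → ι × ι) : ‖walkWeight F f‖ ≤ (b ^ 2) ^ (k + 1) := by
  rw [walkWeight, List.ofFn_succ, List.prod_cons, Matrix.trace]
  refine (norm_sum_le _ _).trans ((Finset.sum_le_sum fun i _ =>
    norm_rankOneTerm_mul_apply_le hb (f 0) _ i i).trans ?_)
  rw [Finset.sum_ite_eq' Finset.univ (f 0).1, if_pos (Finset.mem_univ _), pow_succ' (b ^ 2) k]
  have h := sum_norm_list_prod_rankOneTerm_le hb (List.ofFn fun l => f (Fin.succ l)) (f 0).1
  rw [List.map_ofFn, List.length_ofFn] at h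
  exact mul_le_mul_of_nonneg_left h (sq_nonneg b)

end Trace

section DFT

open scoped Matrix.Norms.L2Operator

lemma dftMatrix_apply (n : ℕ) (j t : Fin n) :
    dftMatrix n j t = (1 / (Real.sqrt n : ℂ)) *
      (Complex.exp (2 * Real.pi * Complex.I / n) ^ ((t : ℕ) + 1)) ^ ((j : ℕ) + 1) := by
  rw [dftMatrix, ← Complex.exp_nat_mul, ← Complex.exp_nat_mul]
  congr 2
  push_cast
  ring

lemma norm_exp_two_pi_I_div (n : ℕ) : ‖Complex.exp (2 * Real.pi * Complex.I / n)‖ = 1 := by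
  rw [show 2 * Real.pi * Complex.I / n = ((2 * Real.pi / n : ℝ) : ℂ) * Complex.I by
    push_cast; ring]
  exact Complex.norm_exp_ofReal_mul_I _

lemma norm_dftMatrix_apply (n : ℕ) (j t : Fin n) : ‖dftMatrix n j t‖ = 1 / Real.sqrt n := by
  rw [dftMatrix_apply, norm_mul, norm_pow, norm_pow, norm_exp_two_pi_I_div, one_pow, one_pow,
    mul_one, norm_div, norm_one, Complex.norm_real, Real.norm_of_nonneg (Real.sqrt_nonneg _)]

lemma dftMatrix_conjTranspose_mul_self {n : ℕ} (hn : 0 < n) :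
    (dftMatrix n)ᴴ * dftMatrix n = 1 := by
  have hn' : (n : ℂ) ≠ 0 := by exact_mod_cast hn.ne'
  have hsq : (1 / (Real.sqrt n : ℂ)) * (1 / (Real.sqrt n : ℂ)) = 1 / n := by
    rw [div_mul_div_comm, ← Complex.ofReal_mul, Real.mul_self_sqrt n.cast_nonneg]
    simp
  set ζ := Complex.exp (2 * Real.pi * Complex.I / n) with hζ
  have hprim : IsPrimitiveRoot ζ n := Complex.isPrimitiveRoot_exp n hn.ne'
  have hζ0 : ζ ≠ 0 := Complex.exp_ne_zero _
  have hstar : ∀ m, star (ζ ^ m) = (ζ ^ m)⁻¹ := fun m => by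
    rw [Complex.inv_eq_conj (by rw [norm_pow, norm_exp_two_pi_I_div, one_pow])]
    rfl
  ext t t'
  set z := star (ζ ^ ((t : ℕ) + 1)) * ζ ^ ((t' : ℕ) + 1) with hz
  have hterm : ∀ j : Fin n, (dftMatrix n)ᴴ t j * dftMatrix n j t' = 1 / n * (z * z ^ (j : ℕ)) := by
    intro j
    rw [Matrix.conjTranspose_apply, dftMatrix_apply, dftMatrix_apply, ← hsq, ← pow_succ', hz,
      mul_pow, star_mul', star_pow (ζ ^ _)]
    have : star (1 / (Real.sqrt n : ℂ)) = 1 / (Real.sqrt n : ℂ) := by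
      simp
    rw [this]
    ring
  rw [Matrix.mul_apply, Finset.sum_congr rfl fun j _ => hterm j, ← Finset.mul_sum,
    ← Finset.mul_sum, Fin.sum_univ_eq_sum_range (fun j => z ^ j) n]
  by_cases h : t = t'
  · subst h
    have hz1 : z = 1 := by rw [hz, hstar, inv_mul_cancel₀ (pow_ne_zero _ hζ0)]
    simp [hz1, hn']
  · have hz1 : z ≠ 1 := by
      rw [hz, hstar, Ne, inv_mul_eq_one₀ (pow_ne_zero _ hζ0), pow_succ, pow_succ]
      intro heq
      exact h (Fin.ext (hprim.pow_inj t.2 t'.2 (mul_right_cancel₀ hζ0 heq)))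
    have hzn : z ^ n = 1 := by
      rw [hz, mul_pow, ← star_pow, ← pow_mul, ← pow_mul, mul_comm _ n, mul_comm _ n, pow_mul,
        pow_mul, hprim.pow_eq_one]
      simp
    rw [geom_sum_eq hz1, hzn, Matrix.one_apply_ne h]
    simp

lemma norm_dftMatrix_le {n : ℕ} (hn : 0 < n) : ‖dftMatrix n‖ ≤ 1 := by
  have h1 : ‖(1 : Matrix (Fin n) (Fin n) ℂ)‖ ≤ 1 := by
    rw [← Matrix.diagonal_one, Matrix.l2_opNorm_diagonal, pi_norm_le_iff_of_nonneg zero_le_one]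
    simp
  have h2 := Matrix.l2_opNorm_conjTranspose_mul_self (dftMatrix n)
  rw [dftMatrix_conjTranspose_mul_self hn] at h2
  exact le_of_not_gt fun h => by nlinarith

end DFT

section MomentPolynomial

variable {ι : Type*}

/-- The number of distinct rows plus the number of distinct columns visited by a walk. -/
noncomputable def walkSupport {k : ℕ} (f : Fin k → ι × ι) : ℕ :=
  (Finset.univ.image fun l => (f l).1).card + (Finset.univ.image fun l => (f l).2).card

lemma walkSupport_le {k : ℕ} (f : Fin k → ι × ι) : walkSupport f ≤ 2 * k := by
  rw [two_mul]
  refine add_le_add ?_ ?_ <;> exact Finset.card_image_le.trans (by simp)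

variable [Fintype ι]

lemma card_filter_walkSupport_lt_le (k D : ℕ) (hD : D ≤ 2 * Fintype.card ι) :
    (Finset.univ.filter fun f : Fin k → ι × ι => walkSupport f < D).card ≤
      (2 * Fintype.card ι) ^ D * (D ^ 2) ^ k := by
  have hsub : (Finset.univ.filter fun f : Fin k → ι × ι => walkSupport f < D) ⊆
      (Finset.powersetCard D (Finset.univ : Finset (ι ⊕ ι))).biUnion fun S =>
        Fintype.piFinset fun _ : Fin k => S.toLeft ×ˢ S.toRight := by
    intro f hf
    rw [Finset.mem_filter] at hf
    set R := (Finset.univ.image fun l => (f l).1).disjSum (Finset.univ.image fun l => (f l).2)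
    obtain ⟨S, hRS, hS⟩ := Finset.exists_superset_card_eq (s := R) (n := D)
      (by rw [Finset.card_disjSum]; exact hf.2.le) (by rw [Fintype.card_sum]; omega)
    refine Finset.mem_biUnion.mpr ⟨S, Finset.mem_powersetCard.mpr ⟨Finset.subset_univ _, hS⟩, ?_⟩
    refine Fintype.mem_piFinset.mpr fun l => Finset.mem_product.mpr ⟨?_, ?_⟩
    · exact Finset.mem_toLeft.mpr (hRS (Finset.inl_mem_disjSum.mpr
        (Finset.mem_image_of_mem (fun l => (f l).1) (Finset.mem_univ l))))
    · exact Finset.mem_toRight.mpr (hRS (Finset.inr_mem_disjSum.mpr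
        (Finset.mem_image_of_mem (fun l => (f l).2) (Finset.mem_univ l))))
  refine (Finset.card_le_card hsub).trans (Finset.card_biUnion_le.trans ?_)
  have hcard : ∀ S ∈ Finset.powersetCard D (Finset.univ : Finset (ι ⊕ ι)),
      (Fintype.piFinset fun _ : Fin k => S.toLeft ×ˢ S.toRight).card ≤ (D ^ 2) ^ k := by
    intro S hS
    rw [Fintype.card_piFinset, Finset.prod_const, Finset.card_univ, Fintype.card_fin,
      Finset.card_product, ← (Finset.mem_powersetCard.mp hS).2, sq]
    exact Nat.pow_le_pow_left (Nat.mul_le_mul Finset.card_toLeft_le Finset.card_toRight_le) k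
  refine (Finset.sum_le_card_nsmul _ _ _ hcard).trans ?_
  rw [Finset.card_powersetCard, Finset.card_univ, Fintype.card_sum, ← two_mul, smul_eq_mul]
  exact Nat.mul_le_mul_right _ (Nat.choose_le_pow _ _)

/-- The expected trace of `(A * Aᴴ) ^ k`, where `A` is the submatrix of `F` whose rows are selected
independently with probability `y` and whose columns are selected independently with probability
`x`. -/
noncomputable def expectedTracePow (F : Matrix ι ι ℂ) (y x : ℝ) (k : ℕ) : ℝ :=
  ∑ S : Finset ι, ∑ T : Finset ι, bernoulliWeight y S * bernoulliWeight x T *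
    ((compress F S T * (compress F S T)ᴴ) ^ k).trace.re

open scoped Matrix.Norms.L2Operator

lemma expectedTracePow_nonneg (F : Matrix ι ι ℂ) {y x : ℝ} (hy : y ∈ Set.Icc (0 : ℝ) 1)
    (hx : x ∈ Set.Icc (0 : ℝ) 1) (k : ℕ) : 0 ≤ expectedTracePow F y x k :=
  Finset.sum_nonneg fun S _ => Finset.sum_nonneg fun T _ =>
    mul_nonneg (mul_nonneg (bernoulliWeight_nonneg hy.1 hy.2 S) (bernoulliWeight_nonneg hx.1 hx.2 T))
      (re_trace_pow_nonneg (Matrix.posSemidef_self_mul_conjTranspose _) k)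

lemma norm_mul_conjTranspose_self (A : Matrix ι ι ℂ) : ‖A * Aᴴ‖ = ‖A‖ ^ 2 := by
  have h := Matrix.l2_opNorm_conjTranspose_mul_self Aᴴ
  rw [Matrix.conjTranspose_conjTranspose, Matrix.l2_opNorm_conjTranspose] at h
  rw [h, sq]

lemma expectedTracePow_le_card {F : Matrix ι ι ℂ} (hF : ‖F‖ ≤ 1) {y x : ℝ}
    (hy : y ∈ Set.Icc (0 : ℝ) 1) (hx : x ∈ Set.Icc (0 : ℝ) 1) (k : ℕ) :
    expectedTracePow F y x k ≤ Fintype.card ι := by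
  calc expectedTracePow F y x k
      ≤ ∑ S : Finset ι, ∑ T : Finset ι,
          bernoulliWeight y S * bernoulliWeight x T * (Fintype.card ι : ℝ) := by
        refine Finset.sum_le_sum fun S _ => Finset.sum_le_sum fun T _ =>
          mul_le_mul_of_nonneg_left ?_ (mul_nonneg (bernoulliWeight_nonneg hy.1 hy.2 S)
            (bernoulliWeight_nonneg hx.1 hx.2 T))
        refine re_trace_pow_le_card (Matrix.posSemidef_self_mul_conjTranspose _) ?_ k
        rw [norm_mul_conjTranspose_self]
        exact pow_le_one₀ (norm_nonneg _) (norm_compress_le hF S T)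
    _ = Fintype.card ι := by
        simp_rw [← Finset.sum_mul, ← Finset.mul_sum, sum_bernoulliWeight, mul_one,
          sum_bernoulliWeight, one_mul]

lemma expectedTracePow_eq_sum (F : Matrix ι ι ℂ) (θ s : ℝ) (k : ℕ) :
    expectedTracePow F s (θ * s) (k + 1) = ∑ f : Fin (k + 1) → ι × ι,
      θ ^ (Finset.univ.image fun l => (f l).2).card * (walkWeight F f).re *
        s ^ walkSupport f := by
  have htr : ∀ S T : Finset ι, ((compress F S T * (compress F S T)ᴴ) ^ (k + 1)).trace.re =
      ∑ f : Fin (k + 1) → ι × ι, (if (Finset.univ.image fun l => (f l).1) ⊆ S then 1 else 0) *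
        (if (Finset.univ.image fun l => (f l).2) ⊆ T then 1 else 0) * (walkWeight F f).re := by
    intro S T
    rw [trace_compress_mul_conjTranspose_pow, trace_pow_eq_sum_walkWeight, Complex.re_sum]
    refine Finset.sum_congr rfl fun f _ => ?_
    simp only [Finset.image_subset_iff, Finset.mem_univ, true_imp_iff]
    by_cases h1 : ∀ l, (f l).1 ∈ S <;> by_cases h2 : ∀ l, (f l).2 ∈ T <;> simp [h1, h2]
  have hone : ∀ (y : ℝ) (A : Finset ι),
      ∑ S : Finset ι, bernoulliWeight y S * (if A ⊆ S then 1 else 0) = y ^ A.card := fun y A => by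
    rw [← sum_bernoulliWeight_of_subset]; simp
  calc expectedTracePow F s (θ * s) (k + 1)
      = ∑ f : Fin (k + 1) → ι × ι, ∑ S : Finset ι, ∑ T : Finset ι,
          (bernoulliWeight s S * (if (Finset.univ.image fun l => (f l).1) ⊆ S then 1 else 0)) *
          (bernoulliWeight (θ * s) T *
            (if (Finset.univ.image fun l => (f l).2) ⊆ T then 1 else 0)) *
          (walkWeight F f).re := by
        simp_rw [expectedTracePow, htr, Finset.mul_sum]
        rw [Finset.sum_comm (s := Finset.univ (α := Fin (k + 1) → ι × ι))]
        refine Finset.sum_congr rfl fun S _ => ?_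
        rw [Finset.sum_comm]
        exact Finset.sum_congr rfl fun f _ => Finset.sum_congr rfl fun T _ => by ring
    _ = _ := by
        refine Finset.sum_congr rfl fun f _ => ?_
        simp_rw [← Finset.sum_mul, ← Finset.mul_sum, hone, ← Finset.sum_mul, hone]
        rw [walkSupport, mul_pow, pow_add]
        ring

/-- Extrapolation of the moment bound: the monomials of low degree are negligible because few
walks have small support, and the remaining ones are controlled by the values at large
probabilities. -/
lemma expectedTracePow_le {F : Matrix ι ι ℂ} (hF : ‖F‖ ≤ 1) {b : ℝ} (hb : ∀ i j, ‖F i j‖ ≤ b)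
    {θ s : ℝ} (hθ : θ ∈ Set.Icc (0 : ℝ) 1) (hs : s ∈ Set.Icc (0 : ℝ) 1) (k D : ℕ)
    (hD : D ≤ 2 * Fintype.card ι) {η : ℝ}
    (hη : (2 * Fintype.card ι : ℝ) ^ D * ((D : ℝ) ^ 2) ^ (k + 1) * (b ^ 2) ^ (k + 1) ≤ η) :
    expectedTracePow F s (θ * s) (k + 1) ≤
      η + s ^ D * ((Fintype.card ι + η) * 2 ^ D * 11 ^ (2 * (k + 1) - D)) := by
  set c : (Fin (k + 1) → ι × ι) → ℝ := fun f =>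
    θ ^ (Finset.univ.image fun l => (f l).2).card * (walkWeight F f).re with hc
  set low : ℝ → ℝ := fun x =>
    ∑ f ∈ Finset.univ.filter (fun f : Fin (k + 1) → ι × ι => walkSupport f < D),
      c f * x ^ walkSupport f with hlow
  set r : ℝ[X] :=
    ∑ f ∈ Finset.univ.filter (fun f : Fin (k + 1) → ι × ι => ¬ walkSupport f < D),
      Polynomial.C (c f) * Polynomial.X ^ (walkSupport f - D) with hr
  have hsplit : ∀ x, expectedTracePow F x (θ * x) (k + 1) = low x + x ^ D * r.eval x := by
    intro x
    rw [expectedTracePow_eq_sum, ← Finset.sum_filter_add_sum_filter_not Finset.univ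
      (fun f : Fin (k + 1) → ι × ι => walkSupport f < D), hr, Polynomial.eval_finsetSum,
      Finset.mul_sum]
    congr 1
    refine Finset.sum_congr rfl fun f hf => ?_
    have hfD : D ≤ walkSupport f := not_lt.mp (Finset.mem_filter.mp hf).2
    rw [Polynomial.eval_mul, Polynomial.eval_C, Polynomial.eval_pow, Polynomial.eval_X,
      mul_left_comm, ← pow_add, Nat.add_sub_cancel' hfD]
  have hc_le : ∀ f, |c f| ≤ (b ^ 2) ^ (k + 1) := by
    intro f
    rw [hc, abs_mul, abs_pow, abs_of_nonneg hθ.1]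
    calc _ ≤ 1 * (b ^ 2) ^ (k + 1) :=
          mul_le_mul (pow_le_one₀ hθ.1 hθ.2)
            ((Complex.abs_re_le_norm _).trans (norm_walkWeight_le hb f)) (abs_nonneg _) zero_le_one
      _ = _ := one_mul _
  have hlow_le : ∀ x ∈ Set.Icc (0 : ℝ) 1, |low x| ≤ η := by
    intro x hx
    refine le_trans ?_ hη
    calc |low x| ≤ ∑ f ∈ Finset.univ.filter (fun f : Fin (k + 1) → ι × ι => walkSupport f < D),
          (b ^ 2) ^ (k + 1) := by
          refine (Finset.abs_sum_le_sum_abs _ _).trans (Finset.sum_le_sum fun f _ => ?_)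
          rw [abs_mul, abs_pow, abs_of_nonneg hx.1]
          exact (mul_le_of_le_one_right (abs_nonneg _) (pow_le_one₀ hx.1 hx.2)).trans (hc_le f)
      _ ≤ _ := by
          rw [Finset.sum_const, nsmul_eq_mul]
          refine mul_le_mul_of_nonneg_right ?_ (by positivity)
          exact_mod_cast card_filter_walkSupport_lt_le (ι := ι) (k + 1) D hD
  have hdeg : r.natDegree ≤ 2 * (k + 1) - D := by
    refine Polynomial.natDegree_sum_le_of_forall_le _ _ fun f _ => ?_
    refine (Polynomial.natDegree_C_mul_X_pow_le _ _).trans ?_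
    exact Nat.sub_le_sub_right (walkSupport_le f) D
  have hr_le : ∀ x ∈ Set.Icc (1 / 2 : ℝ) 1, |r.eval x| ≤ (Fintype.card ι + η) * 2 ^ D := by
    intro x hx
    have hx01 : x ∈ Set.Icc (0 : ℝ) 1 := ⟨by linarith [hx.1], hx.2⟩
    have hθx : θ * x ∈ Set.Icc (0 : ℝ) 1 :=
      ⟨mul_nonneg hθ.1 hx01.1, mul_le_one₀ hθ.2 hx01.1 hx01.2⟩
    have h1 : x ^ D * |r.eval x| ≤ Fintype.card ι + η := by
      have h2 : x ^ D * r.eval x = expectedTracePow F x (θ * x) (k + 1) - low x := by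
        rw [hsplit]; ring
      have h3 : x ^ D * |r.eval x| = |x ^ D * r.eval x| := by
        rw [abs_mul, abs_of_nonneg (pow_nonneg hx01.1 D)]
      rw [h3, h2]
      refine (abs_sub _ _).trans (add_le_add ?_ (hlow_le x hx01))
      rw [abs_of_nonneg (expectedTracePow_nonneg F hx01 hθx _)]
      exact expectedTracePow_le_card hF hx01 hθx _
    have h4 : 1 ≤ 2 ^ D * x ^ D := by
      rw [← mul_pow]; exact one_le_pow₀ (by linarith [hx.1])
    calc |r.eval x| ≤ 2 ^ D * x ^ D * |r.eval x| := le_mul_of_one_le_left (abs_nonneg _) h4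
      _ = 2 ^ D * (x ^ D * |r.eval x|) := by ring
      _ ≤ 2 ^ D * (Fintype.card ι + η) := by gcongr
      _ = _ := mul_comm _ _
  rw [hsplit]
  refine add_le_add ((le_abs_self _).trans (hlow_le s hs))
    (mul_le_mul_of_nonneg_left ?_ (pow_nonneg hs.1 D))
  exact (le_abs_self _).trans (abs_eval_le_of_abs_eval_le_Icc_half r hdeg hr_le hs)

end MomentPolynomial

section FixedCardinality

lemma uniformPairProb_le_bernoulli {n mT mΩ : ℕ} (hn : 0 < n) (hT : mT ≤ n) (hΩ : mΩ ≤ n)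
    (p : Finset (Fin n) → Finset (Fin n) → Prop) :
    uniformPairProb n mT mΩ p ≤ ((n : ℝ) + 1) ^ 2 * ∑ S : Finset (Fin n), ∑ T : Finset (Fin n),
      if p T S then bernoulliWeight ((mΩ : ℝ) / n) S * bernoulliWeight ((mT : ℝ) / n) T else 0 := by
  have hn' : (0 : ℝ) < n := by exact_mod_cast hn
  have hI : ∀ {m : ℕ}, m ≤ n → (m : ℝ) / n ∈ Set.Icc (0 : ℝ) 1 := fun {m} hm =>
    ⟨by positivity, (div_le_one hn').mpr (by exact_mod_cast hm)⟩
  have hw0 : ∀ S T : Finset (Fin n),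
      0 ≤ bernoulliWeight ((mΩ : ℝ) / n) S * bernoulliWeight ((mT : ℝ) / n) T := fun S T =>
    mul_nonneg (bernoulliWeight_nonneg (hI hΩ).1 (hI hΩ).2 S)
      (bernoulliWeight_nonneg (hI hT).1 (hI hT).2 T)
  set u : ℕ → ℝ := fun m => ((m : ℝ) / n) ^ m * (1 - (m : ℝ) / n) ^ (n - m) with hu
  have hu1 : ∀ {m : ℕ}, m ≤ n → 1 ≤ ((n : ℝ) + 1) * (n.choose m * u m) := fun hm =>
    one_le_succ_mul_choose_mul_bernoulli hn hm
  have hbu : ∀ {m : ℕ} {S : Finset (Fin n)}, S ∈ Finset.powersetCard m Finset.univ →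
      bernoulliWeight ((m : ℝ) / n) S = u m := by
    intro m S hS
    rw [bernoulliWeight, (Finset.mem_powersetCard.mp hS).2, Fintype.card_fin]
  set 𝒬 := ((Finset.powersetCard mT (Finset.univ : Finset (Fin n))) ×ˢ
      (Finset.powersetCard mΩ (Finset.univ : Finset (Fin n)))).filter fun q => p q.1 q.2 with h𝒬
  have hcount : (𝒬.card : ℝ) * (u mΩ * u mT) ≤ ∑ S : Finset (Fin n), ∑ T : Finset (Fin n),
      if p T S then bernoulliWeight ((mΩ : ℝ) / n) S * bernoulliWeight ((mT : ℝ) / n) T else 0 := by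
    rw [Finset.sum_comm, ← Fintype.sum_prod_type' (f := fun T S => if p T S then
      bernoulliWeight ((mΩ : ℝ) / n) S * bernoulliWeight ((mT : ℝ) / n) T else 0),
      ← nsmul_eq_mul, ← Finset.sum_const]
    refine le_trans (Finset.sum_le_sum fun q hq => ?_) (Finset.sum_le_sum_of_subset_of_nonneg
      (Finset.subset_univ 𝒬) fun q _ _ => ?_)
    · obtain ⟨hq1, hq2⟩ := Finset.mem_filter.mp hq
      obtain ⟨hqT, hqS⟩ := Finset.mem_product.mp hq1
      rw [if_pos hq2, hbu hqT, hbu hqS]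
    · split_ifs
      exacts [hw0 _ _, le_rfl]
  have hcT : (0 : ℝ) < n.choose mT := by exact_mod_cast Nat.choose_pos hT
  have hcΩ : (0 : ℝ) < n.choose mΩ := by exact_mod_cast Nat.choose_pos hΩ
  rw [uniformPairProb, ← h𝒬, Finset.card_powersetCard, Finset.card_powersetCard, Finset.card_fin,
    Nat.cast_mul, div_le_iff₀ (by positivity)]
  calc (𝒬.card : ℝ) = 𝒬.card * (1 * 1) := by ring
    _ ≤ 𝒬.card * ((((n : ℝ) + 1) * (n.choose mT * u mT)) *
          (((n : ℝ) + 1) * (n.choose mΩ * u mΩ))) := by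
        gcongr
        · exact zero_le_one.trans (hu1 hT)
        · exact hu1 hT
        · exact hu1 hΩ
    _ = ((n : ℝ) + 1) ^ 2 * (𝒬.card * (u mΩ * u mT)) * (n.choose mT * n.choose mΩ) := by ring
    _ ≤ _ := by gcongr

open scoped Matrix.Norms.L2Operator

lemma uniformPairProb_le_expectedTracePow {n mT mΩ : ℕ} (hn : 0 < n) (hT : mT ≤ n)
    (hΩ : mΩ ≤ n) (hΩ0 : 0 < mΩ) (k : ℕ) :
    uniformPairProb n mT mΩ
        (fun T Ω => 9 ≤ Real.sqrt ((n : ℝ) / mΩ) * specNorm (dftSub n Ω T)) ≤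
      ((n : ℝ) + 1) ^ 2 * (expectedTracePow (dftMatrix n) ((mΩ : ℝ) / n) ((mT : ℝ) / n) k /
        (81 * ((mΩ : ℝ) / n)) ^ k) := by
  have hn' : (0 : ℝ) < n := by exact_mod_cast hn
  have hΩ' : (0 : ℝ) < mΩ := by exact_mod_cast hΩ0
  have hI : ∀ {m : ℕ}, m ≤ n → (m : ℝ) / n ∈ Set.Icc (0 : ℝ) 1 := fun {m} hm =>
    ⟨by positivity, (div_le_one hn').mpr (by exact_mod_cast hm)⟩
  have : Nonempty (Fin n) := ⟨⟨0, hn⟩⟩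
  refine (uniformPairProb_le_bernoulli hn hT hΩ _).trans ?_
  refine mul_le_mul_of_nonneg_left ?_ (by positivity)
  rw [expectedTracePow, Finset.sum_div]
  refine Finset.sum_le_sum fun S _ => ?_
  rw [Finset.sum_div]
  refine Finset.sum_le_sum fun T _ => ?_
  have hw := mul_nonneg (bernoulliWeight_nonneg (hI hΩ).1 (hI hΩ).2 S)
      (bernoulliWeight_nonneg (hI hT).1 (hI hT).2 T)
  have hpsd := Matrix.posSemidef_self_mul_conjTranspose (compress (dftMatrix n) S T)
  rw [mul_div_assoc]
  split_ifs with h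
  · refine le_mul_of_one_le_right hw ?_
    rw [one_le_div (by positivity)]
    refine le_trans ?_ (norm_pow_le_re_trace_pow hpsd k)
    rw [norm_mul_conjTranspose_self]
    refine pow_le_pow_left₀ (by positivity) ?_ k
    have hsub : dftSub n S T =
        (compress (dftMatrix n) S T).submatrix (fun i : S => (i : Fin n)) fun j : T => (j : Fin n) := by
      ext i j
      rw [Matrix.submatrix_apply, compress_apply_of_mem _ i.2 j.2]
      rfl
    have hle : 9 ≤ Real.sqrt ((n : ℝ) / mΩ) * ‖compress (dftMatrix n) S T‖ := by
      refine h.trans (mul_le_mul_of_nonneg_left ?_ (Real.sqrt_nonneg _))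
      rw [hsub]
      exact specNorm_submatrix_le _ S T
    have hsq : (81 : ℝ) ≤ n / mΩ * ‖compress (dftMatrix n) S T‖ ^ 2 := by
      calc (81 : ℝ) = 9 ^ 2 := by norm_num
        _ ≤ (Real.sqrt ((n : ℝ) / mΩ) * ‖compress (dftMatrix n) S T‖) ^ 2 :=
          pow_le_pow_left₀ (by norm_num) hle 2
        _ = _ := by rw [mul_pow, Real.sq_sqrt (by positivity)]
    calc 81 * ((mΩ : ℝ) / n) ≤ n / mΩ * ‖compress (dftMatrix n) S T‖ ^ 2 * (mΩ / n) := by gcongr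
      _ = ‖compress (dftMatrix n) S T‖ ^ 2 := by field_simp
      _ ≤ _ := le_of_eq (by congr)
  · exact mul_nonneg hw (div_nonneg (re_trace_pow_nonneg hpsd k) (by positivity))

end FixedCardinality

section Threshold

open Filter

lemma eventually_mul_log_pow_le (K : ℝ) (m : ℕ) :
    ∀ᶠ n : ℕ in atTop, K * ((Nat.log 2 n + 1 : ℕ) : ℝ) ^ m ≤ n := by
  have hlog : Tendsto (fun n : ℕ => Nat.log 2 n + 1) atTop atTop := by
    refine tendsto_atTop.mpr fun b => ?_
    filter_upwards [eventually_ge_atTop (2 ^ b)] with n hn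
    exact (Nat.le_log_of_pow_le one_lt_two hn).trans (Nat.le_succ _)
  have hlim := ((tendsto_pow_const_div_const_pow_of_one_lt m (one_lt_two (α := ℝ))).const_mul
    K).comp hlog
  rw [mul_zero] at hlim
  filter_upwards [hlim.eventually_lt_const one_half_pos, eventually_ge_atTop 1] with n hn h1
  have hpow : (2 : ℝ) ^ Nat.log 2 n ≤ n := by
    exact_mod_cast Nat.pow_log_le_self 2 (by omega)
  rw [Function.comp_apply, ← mul_div_assoc, div_lt_iff₀ (by positivity)] at hn
  refine hn.le.trans (le_of_eq_of_le ?_ hpow)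
  rw [pow_succ]
  ring

/-- The two error terms in the moment estimate at exponent `p * L` are absorbed by `44 ^ (p * L)`
once `11 / δ ≤ 2 ^ p`. -/
lemma add_extrapolation_error_le {δ : ℝ} (h0 : 0 < δ) (h1 : δ < 1) {p : ℕ} (hp : 1 ≤ p)
    (hδp : 11 / δ ≤ 2 ^ p) (L : ℕ) (n : ℕ) :
    δ ^ (p * L) + δ ^ (p * L - L) * ((n + δ ^ (p * L)) * 2 ^ (p * L - L) *
      11 ^ (2 * (p * L) - (p * L - L))) ≤ (44 * δ) ^ (p * L) * (n + 2) := by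
  set k := p * L with hk
  have hLk : L ≤ k := Nat.le_mul_of_pos_left L hp
  have hexp : 2 * k - (k - L) = k + L := by omega
  have hδk : δ ^ k ≤ 1 := pow_le_one₀ h0.le h1.le
  have hswap : δ ^ (k - L) * 11 ^ (k + L) ≤ δ ^ k * 11 ^ k * 2 ^ k := by
    have hsplit : δ ^ k = δ ^ (k - L) * δ ^ L := by rw [← pow_add, Nat.sub_add_cancel hLk]
    calc δ ^ (k - L) * 11 ^ (k + L) = δ ^ k * 11 ^ k * (11 / δ) ^ L := by
          rw [hsplit, pow_add, div_pow]
          field_simp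
      _ ≤ δ ^ k * 11 ^ k * (2 ^ p) ^ L := by gcongr
      _ = _ := by rw [← pow_mul]
  have h44 : (44 : ℝ) ^ k = 11 ^ k * 2 ^ k * 2 ^ k := by
    rw [← mul_pow, ← mul_pow]
    norm_num
  rw [hexp]
  calc δ ^ k + δ ^ (k - L) * ((n + δ ^ k) * 2 ^ (k - L) * 11 ^ (k + L))
      = δ ^ k + (n + δ ^ k) * 2 ^ (k - L) * (δ ^ (k - L) * 11 ^ (k + L)) := by ring
    _ ≤ (44 * δ) ^ k + (n + 1) * 2 ^ k * (δ ^ k * 11 ^ k * 2 ^ k) := by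
        gcongr
        · linarith
        · norm_num
        · omega
    _ = _ := by
        rw [mul_pow, h44]
        ring

lemma polynomial_mul_geometric_le {n L p : ℕ} (hn : 2 ≤ n) (hL : n ≤ 2 ^ L) (hp : 10 ≤ p) :
    ((n : ℝ) + 1) ^ 2 * ((44 / 81) ^ (p * L) * (n + 2)) ≤ (n : ℝ)⁻¹ := by
  have hn' : (2 : ℝ) ≤ n := by exact_mod_cast hn
  have hL' : (n : ℝ) ≤ 2 ^ L := by exact_mod_cast hL
  have hgeom : (44 / 81 : ℝ) ^ (p * L) ≤ ((n : ℝ) ^ 8)⁻¹ := by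
    calc (44 / 81 : ℝ) ^ (p * L) ≤ (44 / 81) ^ (10 * L) :=
          pow_le_pow_of_le_one (by norm_num) (by norm_num) (Nat.mul_le_mul_right L hp)
      _ = ((44 / 81) ^ 10) ^ L := pow_mul _ _ _
      _ ≤ ((2 ^ 8)⁻¹) ^ L := by gcongr; norm_num
      _ = ((2 ^ L) ^ 8)⁻¹ := by rw [inv_pow, ← pow_mul, ← pow_mul, mul_comm]
      _ ≤ _ := by gcongr
  have h8 : (8 : ℝ) ≤ n ^ 4 := by
    calc (8 : ℝ) ≤ 2 ^ 4 := by norm_num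
      _ ≤ n ^ 4 := by gcongr
  calc ((n : ℝ) + 1) ^ 2 * ((44 / 81) ^ (p * L) * (n + 2))
      ≤ (n + n) ^ 2 * (((n : ℝ) ^ 8)⁻¹ * (n + n)) := by
        gcongr
        linarith
    _ = 8 * ((n : ℝ) ^ 5)⁻¹ := by
        field_simp
        ring
    _ ≤ n ^ 4 * ((n : ℝ) ^ 5)⁻¹ := by gcongr
    _ = _ := by field_simp

/-- The coefficient bound on walks of small support is negligible when `n` exceeds a fixed power
of the logarithmic moment order. -/
lemma low_degree_bound_le {δ : ℝ} (h0 : 0 < δ) {n p L : ℕ} (hn : 0 < n) (hp : 1 ≤ p)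
    (hlarge : (2 * ((p * L : ℕ) : ℝ) ^ 2 / δ) ^ p ≤ n) :
    (2 * n : ℝ) ^ (p * L - L) * (((p * L - L : ℕ) : ℝ) ^ 2) ^ (p * L) *
      ((1 / Real.sqrt n) ^ 2) ^ (p * L) ≤ δ ^ (p * L) := by
  have hn' : (0 : ℝ) < n := by exact_mod_cast hn
  set k := p * L with hk
  have hLk : L ≤ k := Nat.le_mul_of_pos_left L hp
  have hpow : (2 * (k : ℝ) ^ 2 / δ) ^ k ≤ (n : ℝ) ^ L := by
    rw [hk, pow_mul, ← hk]
    gcongr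
  have hsplit : (n : ℝ) ^ k = n ^ (k - L) * n ^ L := by
    rw [← pow_add, Nat.sub_add_cancel hLk]
  rw [div_pow, div_le_iff₀ (by positivity), mul_pow] at hpow
  have hsq : (1 / Real.sqrt n) ^ 2 = (n : ℝ)⁻¹ := by
    rw [div_pow, Real.sq_sqrt hn'.le, one_pow, one_div]
  rw [hsq, inv_pow, ← div_eq_mul_inv, div_le_iff₀ (by positivity)]
  calc (2 * n : ℝ) ^ (k - L) * (((k - L : ℕ) : ℝ) ^ 2) ^ k
      = n ^ (k - L) * (2 ^ (k - L) * (((k - L : ℕ) : ℝ) ^ 2) ^ k) := by rw [mul_pow]; ring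
    _ ≤ n ^ (k - L) * (2 ^ k * ((k : ℝ) ^ 2) ^ k) := by
        gcongr
        · norm_num
        · omega
        · omega
    _ ≤ n ^ (k - L) * (n ^ L * δ ^ k) := by gcongr
    _ = _ := by rw [hsplit]; ring

end Threshold

/-- There are absolute constants `c > 0` and `C > 0` and, for each `δ ∈ (0, c)`, a threshold
`N(δ)` such that for `n ≥ N(δ)`: if `|T| ≤ |Ω| = δn` and `T, Ω` are independent uniformly
random subsets of `{1,…,n}` of fixed cardinalities `|T|` and `|Ω|`, then
`P(√(n/|Ω|) ‖F_{ΩT}‖ ≥ 9) ≤ n^{−C}`. -/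
theorem stmt_12 :
    ∃ c C : ℝ, 0 < c ∧ 0 < C ∧
      ∀ δ : ℝ, 0 < δ → δ < c → ∃ N : ℕ, ∀ n : ℕ, N ≤ n → ∀ mT mΩ : ℕ,
        (mΩ : ℝ) = δ * n → mT ≤ mΩ →
        uniformPairProb n mT mΩ
            (fun T Ω => 9 ≤ Real.sqrt ((n : ℝ) / mΩ) * specNorm (dftSub n Ω T)) ≤
          (n : ℝ) ^ (-C) := by
  refine ⟨1, 1, one_pos, one_pos, fun δ hδ0 hδ1 => ?_⟩
  obtain ⟨p, hp, hδp⟩ : ∃ p : ℕ, 10 ≤ p ∧ 11 / δ ≤ 2 ^ p := by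
    obtain ⟨q, hq⟩ := pow_unbounded_of_one_lt (11 / δ) (one_lt_two (α := ℝ))
    exact ⟨q + 10, by omega, hq.le.trans (pow_le_pow_right₀ one_le_two (by omega))⟩
  obtain ⟨N, hN⟩ := Filter.eventually_atTop.mp
    (eventually_mul_log_pow_le ((2 * (p : ℝ) ^ 2 / δ) ^ p) (2 * p))
  refine ⟨max N 2, fun n hn mT mΩ hmΩ hTΩ => ?_⟩
  have hn2 : 2 ≤ n := (le_max_right N 2).trans hn
  have hn0 : 0 < n := by omega
  have hn' : (0 : ℝ) < n := by exact_mod_cast hn0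
  have hs : (mΩ : ℝ) / n = δ := by rw [hmΩ]; field_simp
  have hΩ0 : 0 < mΩ := by
    have : (0 : ℝ) < mΩ := by rw [hmΩ]; positivity
    exact_mod_cast this
  have hΩ0' : (0 : ℝ) < mΩ := by exact_mod_cast hΩ0
  have hΩn : mΩ ≤ n := by
    have : (mΩ : ℝ) ≤ n := by rw [hmΩ]; exact mul_le_of_le_one_left hn'.le hδ1.le
    exact_mod_cast this
  obtain ⟨L, hL⟩ : ∃ L, L = Nat.log 2 n + 1 := ⟨_, rfl⟩
  have hnL : n ≤ 2 ^ L := hL ▸ (Nat.lt_pow_succ_log_self one_lt_two n).le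
  have hkpos : 0 < p * L := Nat.mul_pos (by omega) (by omega)
  have hlarge : (2 * ((p * L : ℕ) : ℝ) ^ 2 / δ) ^ p ≤ n := by
    have hNn := hN n ((le_max_left N 2).trans hn)
    rw [← hL, pow_mul, ← mul_pow] at hNn
    refine le_of_eq_of_le (congrArg (· ^ p) ?_) hNn
    rw [Nat.cast_mul]
    ring
  have hkn : p * L ≤ n := by
    have hk1 : (1 : ℝ) ≤ (p * L : ℕ) := by exact_mod_cast hkpos
    have hbase : ((p * L : ℕ) : ℝ) ≤ 2 * ((p * L : ℕ) : ℝ) ^ 2 / δ := by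
      rw [le_div_iff₀ hδ0]
      nlinarith
    have := (hbase.trans (le_self_pow₀ (hk1.trans hbase) (by omega))).trans hlarge
    exact_mod_cast this
  obtain ⟨k, hk⟩ : ∃ k, p * L = k + 1 := ⟨p * L - 1, by omega⟩
  have hmoment := expectedTracePow_le (F := dftMatrix n) (by convert norm_dftMatrix_le hn0)
    (fun i j => (norm_dftMatrix_apply n i j).le) (θ := (mT : ℝ) / mΩ) (s := δ)
    ⟨by positivity, (div_le_one hΩ0').mpr (by exact_mod_cast hTΩ)⟩ ⟨hδ0.le, hδ1.le⟩ k (p * L - L)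
    (by rw [Fintype.card_fin]; omega) (η := δ ^ (p * L))
    (by
      rw [Fintype.card_fin, ← hk]
      exact low_degree_bound_le hδ0 hn0 (by omega) hlarge)
  have hθs : (mT : ℝ) / mΩ * δ = mT / n := by
    rw [← hs]
    field_simp
  rw [hθs, ← hk, Fintype.card_fin] at hmoment
  have hprob := uniformPairProb_le_expectedTracePow hn0 (hTΩ.trans hΩn) hΩn hΩ0 (p * L)
  rw [hs] at hprob
  rw [Real.rpow_neg_one]
  refine hprob.trans (le_trans ?_ (polynomial_mul_geometric_le hn2 hnL hp))
  refine mul_le_mul_of_nonneg_left ?_ (by positivity)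
  rw [div_le_iff₀ (by positivity)]
  refine (hmoment.trans (add_extrapolation_error_le hδ0 hδ1 (by omega) hδp L n)).trans_eq ?_
  rw [mul_right_comm, ← mul_pow]
  congr 2
  ring
end

section
/- (Chebyshev extrapolation; Bourgain–Tzafriri) Suppose A is an n×n complex matrix with ‖A‖ ≤ 1. Let q be an integer satisfying 13 log n ≤ q ≤ n/2. Choose parameters ϱ ∈ (0,1) and δ ∈ [ϱ, 1]. Then for each λ ∈ [0,1], ( E ‖R_δ A R'_δ‖^{2q} )^{1/(2q)} ≤ 8 δ^{λ} max{ 1, ϱ^{−λ} ( E ‖R_ϱ A R'_ϱ‖^{2q} )^{1/(2q)} }. The same inequality holds if R'_δ is replaced by R_δ and R'_ϱ is replaced by R_ϱ (i.e., with the same projector on both sides). -/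
attribute [local instance] Classical.propDecidable

/-- The diagonal 0–1 projector matrix onto the coordinates in `S`. -/
def projMatrix {n : ℕ} (S : Finset (Fin n)) : Matrix (Fin n) (Fin n) ℂ :=
  Matrix.diagonal fun i => if i ∈ S then 1 else 0

/-- The probability that a random diagonal projector `R_δ`, whose diagonal entries are
independent 0–1 Bernoulli variables of mean `δ`, projects onto a coordinate set satisfying
`p`.  (The Bernoulli product measure assigns mass `δ^|S| (1−δ)^{n−|S|}` to the set `S`.) -/
noncomputable def bernSetProb (n : ℕ) (δ : ℝ) (p : Finset (Fin n) → Prop) : ℝ :=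
  ∑ S ∈ (Finset.univ : Finset (Fin n)).powerset.filter p,
    δ ^ S.card * (1 - δ) ^ (n - S.card)

/-- The probability that two independent Bernoulli(δ) random coordinate sets `S, S'`
(for `R_δ` and an independent copy `R'_δ`) satisfy `p`. -/
noncomputable def bernPairProb (n : ℕ) (δ : ℝ)
    (p : Finset (Fin n) → Finset (Fin n) → Prop) : ℝ :=
  ∑ q ∈ ((Finset.univ : Finset (Fin n)).powerset ×ˢ
      (Finset.univ : Finset (Fin n)).powerset).filter fun q => p q.1 q.2,
    (δ ^ q.1.card * (1 - δ) ^ (n - q.1.card)) * (δ ^ q.2.card * (1 - δ) ^ (n - q.2.card))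

/-- The expectation `E f(S, S')` over two independent Bernoulli(δ) random coordinate sets
`S, S'` (the coordinate sets of `R_δ` and an independent copy `R'_δ`). -/
noncomputable def bernPairExp (n : ℕ) (δ : ℝ)
    (f : Finset (Fin n) → Finset (Fin n) → ℝ) : ℝ :=
  ∑ S ∈ (Finset.univ : Finset (Fin n)).powerset,
    ∑ S' ∈ (Finset.univ : Finset (Fin n)).powerset,
      (δ ^ S.card * (1 - δ) ^ (n - S.card)) * (δ ^ S'.card * (1 - δ) ^ (n - S'.card)) * f S S'

/-- The expectation `E f(S)` over a single Bernoulli(δ) random coordinate set `S` (the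
coordinate set of `R_δ`). -/
noncomputable def bernExp (n : ℕ) (δ : ℝ) (f : Finset (Fin n) → ℝ) : ℝ :=
  ∑ S ∈ (Finset.univ : Finset (Fin n)).powerset,
    (δ ^ S.card * (1 - δ) ^ (n - S.card)) * f S

open Polynomial in
/-- **Coefficient bound from Chebyshev's extremal property.** -/
theorem sum_abs_coeff_mul_pow_le {d : ℕ} {Q : ℝ[X]} (hQ : Q.natDegree ≤ d) {r M : ℝ}
    (hr : 0 < r) (hM : 0 < M) (hbd : ∀ s ∈ Set.Icc 0 r, |Q.eval s| ≤ M) :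
    ∑ k ∈ Finset.range (d + 1), |Q.coeff k| * r ^ k ≤ M * (Chebyshev.T ℝ d).eval 3 := by
  have key : ∀ e : ℝ, |e| = 1 → ∀ k,
      e * ((-1) ^ k * (Q.coeff k * r ^ k)) ≤ M * ((taylor 1 (Chebyshev.T ℝ d)).coeff k * 2 ^ k) := by
    intro e he k
    set P : ℝ[X] := C (e / M) * Q.comp (C (r / 2) * (1 - X)) with hP
    have hdeg : P.degree ≤ d := by
      rw [← natDegree_le_iff_degree_le]
      refine natDegree_C_mul_le _ _ |>.trans <| natDegree_comp_le.trans ?_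
      have h1 : (C (r / 2) * (1 - X : ℝ[X])).natDegree ≤ 1 := by compute_degree
      calc _ ≤ d * 1 := Nat.mul_le_mul hQ h1
        _ = d := mul_one d
    have hb : ∀ x ∈ Set.Icc (-1 : ℝ) 1, |P.eval x| ≤ 1 := by
      rintro x ⟨hx1, hx2⟩
      simp only [hP, eval_mul, eval_C, eval_comp, eval_sub, eval_one, eval_X, abs_mul, abs_div, he,
        abs_of_pos hM]
      rw [one_div, inv_mul_le_iff₀ hM, mul_one]
      refine hbd _ ⟨by nlinarith, by nlinarith⟩
    have hd := Chebyshev.eval_iterate_derivative_le_of_forall_abs_le_one (k := k) le_rfl hdeg hb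
    have hfac : ∀ R : ℝ[X], (derivative^[k] R).eval 1 = (k.factorial : ℝ) * (taylor 1 R).coeff k := by
      intro R
      rw [taylor_coeff, ← factorial_smul_hasseDeriv]
      simp
    rw [hfac, hfac, mul_le_mul_iff_right₀ (by positivity)] at hd
    have ht : taylor 1 P = C (e / M) * Q.comp (C (-(r / 2)) * X) := by
      rw [hP, taylor_mul, taylor_C]
      congr 1
      rw [taylor_apply, comp_assoc]
      congr 1
      simp
    rw [ht, coeff_C_mul, comp_C_mul_X_coeff] at hd
    have h2 : (0 : ℝ) < M * 2 ^ k := by positivity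
    have := mul_le_mul_of_nonneg_left hd h2.le
    calc e * ((-1) ^ k * (Q.coeff k * r ^ k))
        = M * 2 ^ k * (e / M * (Q.coeff k * (-(r / 2)) ^ k)) := by
          rw [neg_pow (r / 2), div_pow]; field_simp
      _ ≤ _ := this
      _ = _ := by ring
  have key' : ∀ k, |Q.coeff k| * r ^ k ≤ M * ((taylor 1 (Chebyshev.T ℝ d)).coeff k * 2 ^ k) := by
    intro k
    have h : |Q.coeff k| * r ^ k = |(-1) ^ k * (Q.coeff k * r ^ k)| := by
      rw [abs_mul, abs_mul, abs_neg_one_pow, one_mul, abs_of_pos (pow_pos hr k)]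
    rw [h]
    refine abs_le'.2 ⟨?_, ?_⟩
    · simpa using key 1 (by simp) k
    · simpa using key (-1) (by simp) k
  calc _ ≤ ∑ k ∈ Finset.range (d + 1), M * ((taylor 1 (Chebyshev.T ℝ d)).coeff k * 2 ^ k) :=
        Finset.sum_le_sum fun k _ => key' k
    _ = M * (taylor 1 (Chebyshev.T ℝ d)).eval 2 := by
        rw [← Finset.mul_sum, eval_eq_sum_range' (n := d + 1)]
        rw [natDegree_taylor, Nat.lt_succ_iff]
        simp
    _ = _ := by rw [taylor_eval]; norm_num

open Polynomial in
theorem two_mul_eval_T_three_le (d : ℕ) :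
    2 * (Chebyshev.T ℝ (d + 1 : ℕ)).eval 3 ≤ 6 ^ (d + 1) := by
  have h : ∀ d : ℕ, 1 ≤ (Chebyshev.T ℝ (d : ℕ)).eval 3 ∧
      2 * (Chebyshev.T ℝ (d + 1 : ℕ)).eval 3 ≤ 6 ^ (d + 1) := by
    intro d
    induction d with
    | zero => norm_num
    | succ d ih =>
      have h1 : ∀ m : ℕ, 1 ≤ (Chebyshev.T ℝ m).eval 3 := fun m =>
        Chebyshev.one_le_eval_T_real m (by norm_num)
      refine ⟨h1 _, ?_⟩
      have := Chebyshev.T_add_two ℝ d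
      push_cast at *
      rw [show (d : ℤ) + 1 + 1 = d + 2 by ring, this]
      simp only [eval_sub, eval_mul, eval_X, eval_ofNat]
      have := ih.2
      rw [pow_succ]
      linarith [h1 d]
  exact (h d).2

open Polynomial in
/-- Polynomial interpolation between the bounds on `[0, ϱ]` and `[0, 1]`. -/
theorem extrapolation_of_polynomial_bounds {n q : ℕ} (hn : 1 ≤ n) (hq : 1 ≤ q)
    (hq1 : 13 * Real.log n ≤ q) {ϱ δ lam : ℝ} (hϱ0 : 0 < ϱ) (hϱ1 : ϱ < 1) (hδϱ : ϱ ≤ δ)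
    (hδ1 : δ ≤ 1) {E : ℝ → ℝ} {Q : ℝ[X]} (hQ : Q.natDegree ≤ 2 * q)
    (hEQ : ∀ s ∈ Set.Icc (0 : ℝ) 1, E s ≤ Q.eval s)
    (hQE : ∀ s ∈ Set.Icc (0 : ℝ) 1, Q.eval s ≤ n * E s)
    (hmono : MonotoneOn E (Set.Icc 0 1)) (hE0 : ∀ s ∈ Set.Icc (0 : ℝ) 1, 0 ≤ E s)
    (hE1 : ∀ s ∈ Set.Icc (0 : ℝ) 1, E s ≤ 1) :
    E δ ^ ((1 : ℝ) / (2 * q)) ≤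
      8 * δ ^ lam * max 1 (ϱ ^ (-lam) * E ϱ ^ ((1 : ℝ) / (2 * q))) := by
  have hδ0 : 0 < δ := hϱ0.trans_le hδϱ
  have hϱI : ϱ ∈ Set.Icc (0 : ℝ) 1 := ⟨hϱ0.le, hϱ1.le⟩
  have hδI : δ ∈ Set.Icc (0 : ℝ) 1 := ⟨hδ0.le, hδ1⟩
  have hn0 : (0 : ℝ) < n := by exact_mod_cast hn
  have hq0 : (0 : ℝ) < 2 * q := by positivity
  set D : ℝ := 2 * q with hD
  set m : ℝ := max 1 (ϱ ^ (-lam) * E ϱ ^ ((1 : ℝ) / D)) with hm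
  have hm1 : 1 ≤ m := le_max_left _ _
  set W : ℝ := m ^ D with hW
  have hW1 : 1 ≤ W := Real.one_le_rpow hm1 hq0.le
  have hEW : E ϱ ≤ ϱ ^ (lam * D) * W := by
    have h1 : E ϱ ^ ((1 : ℝ) / D) ≤ ϱ ^ lam * m := by
      have := le_max_right 1 (ϱ ^ (-lam) * E ϱ ^ ((1 : ℝ) / D))
      rw [← hm, Real.rpow_neg hϱ0.le,
        inv_mul_le_iff₀ (Real.rpow_pos_of_pos hϱ0 _)] at this
      exact this
    have h2 := Real.rpow_le_rpow (Real.rpow_nonneg (hE0 _ hϱI) _) h1 hq0.le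
    rwa [← Real.rpow_mul (hE0 _ hϱI), one_div, inv_mul_cancel₀ hq0.ne', Real.rpow_one,
      Real.mul_rpow (by positivity) (by positivity), ← Real.rpow_mul hϱ0.le] at h2
  have hbd1 : ∀ s ∈ Set.Icc (0 : ℝ) 1, |Q.eval s| ≤ n := by
    intro s hs
    rw [abs_of_nonneg ((hE0 s hs).trans (hEQ s hs))]
    exact (hQE s hs).trans (mul_le_of_le_one_right hn0.le (hE1 s hs))
  have hbd2 : ∀ s ∈ Set.Icc (0 : ℝ) ϱ, |Q.eval s| ≤ n * (ϱ ^ (lam * D) * W) := by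
    intro s hs
    have hs' : s ∈ Set.Icc (0 : ℝ) 1 := ⟨hs.1, hs.2.trans hϱ1.le⟩
    rw [abs_of_nonneg ((hE0 s hs').trans (hEQ s hs'))]
    exact (hQE s hs').trans (mul_le_mul_of_nonneg_left ((hmono hs' hϱI hs.2).trans hEW) hn0.le)
  have hS1 := sum_abs_coeff_mul_pow_le hQ one_pos hn0 hbd1
  have hS2 := sum_abs_coeff_mul_pow_le hQ hϱ0 (by positivity) hbd2
  simp only [one_pow, mul_one] at hS1
  have hterm : ∀ k : ℕ, Q.coeff k * δ ^ k ≤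
      |Q.coeff k| * ϱ ^ k * (δ / ϱ) ^ (lam * D) + |Q.coeff k| * δ ^ (lam * D) := by
    intro k
    have h0 : Q.coeff k * δ ^ k ≤ |Q.coeff k| * δ ^ k :=
      mul_le_mul_of_nonneg_right (le_abs_self _) (by positivity)
    refine h0.trans ?_
    rcases le_total (k : ℝ) (lam * D) with hk | hk
    · refine le_add_of_le_of_nonneg ?_ (by positivity)
      rw [mul_assoc]
      refine mul_le_mul_of_nonneg_left ?_ (abs_nonneg _)
      have h1 : (δ / ϱ) ^ k ≤ (δ / ϱ) ^ (lam * D) := by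
        rw [← Real.rpow_natCast]
        exact Real.rpow_le_rpow_of_exponent_le ((one_le_div hϱ0).2 hδϱ) hk
      calc δ ^ k = ϱ ^ k * (δ / ϱ) ^ k := by rw [← mul_pow]; congr 1; field_simp
        _ ≤ _ := by gcongr
    · refine le_add_of_nonneg_of_le (by positivity) ?_
      refine mul_le_mul_of_nonneg_left ?_ (abs_nonneg _)
      rw [← Real.rpow_natCast]
      exact Real.rpow_le_rpow_of_exponent_ge hδ0 hδ1 hk
  set T : ℝ := (Chebyshev.T ℝ ((2 * q : ℕ) : ℤ)).eval 3 with hT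
  have hT6 : 2 * T ≤ 6 ^ (2 * q) := by
    obtain ⟨j, hj⟩ : ∃ j, 2 * q = j + 1 := ⟨2 * q - 1, by omega⟩
    rw [hT, hj]
    exact two_mul_eval_T_three_le j
  have hT0 : 0 ≤ T := zero_le_one.trans (Chebyshev.one_le_eval_T_real _ (by norm_num))
  have hn8 : (n : ℝ) * 6 ^ (2 * q) ≤ 8 ^ (2 * q) := by
    have h13 : (n : ℝ) ≤ (16 / 9) ^ q := by
      have h2 : Real.log n ≤ q * Real.log (16 / 9) := by
        have : (1 : ℝ) / 13 ≤ Real.log (16 / 9) := by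
          have := Real.one_sub_inv_le_log_of_pos (show (0 : ℝ) < 16 / 9 by norm_num)
          norm_num at this ⊢
          linarith
        have hqq : (0 : ℝ) ≤ q := by positivity
        nlinarith
      rw [← Real.log_pow, Real.log_le_log_iff hn0 (by positivity)] at h2
      exact h2
    calc (n : ℝ) * 6 ^ (2 * q) ≤ (16 / 9) ^ q * 6 ^ (2 * q) := by gcongr
      _ = 8 ^ (2 * q) := by rw [pow_mul, pow_mul, ← mul_pow]; norm_num
  have hfin : E δ ≤ 8 ^ (2 * q) * δ ^ (lam * D) * W := by
    calc E δ ≤ Q.eval δ := hEQ δ hδI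
      _ = ∑ k ∈ Finset.range (2 * q + 1), Q.coeff k * δ ^ k :=
        eval_eq_sum_range' (Nat.lt_succ_iff.2 hQ) δ
      _ ≤ ∑ k ∈ Finset.range (2 * q + 1), (|Q.coeff k| * ϱ ^ k * (δ / ϱ) ^ (lam * D) +
            |Q.coeff k| * δ ^ (lam * D)) := Finset.sum_le_sum fun k _ => hterm k
      _ ≤ n * (ϱ ^ (lam * D) * W) * T * (δ / ϱ) ^ (lam * D) + n * T * δ ^ (lam * D) := by
        rw [Finset.sum_add_distrib, ← Finset.sum_mul, ← Finset.sum_mul]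
        gcongr
      _ = n * T * δ ^ (lam * D) * (W + 1) := by
        rw [Real.div_rpow hδ0.le hϱ0.le]
        have : ϱ ^ (lam * D) ≠ 0 := (Real.rpow_pos_of_pos hϱ0 _).ne'
        field_simp
      _ ≤ n * T * δ ^ (lam * D) * (2 * W) := by gcongr; linarith
      _ = n * (2 * T) * δ ^ (lam * D) * W := by ring
      _ ≤ n * 6 ^ (2 * q) * δ ^ (lam * D) * W := by gcongr
      _ ≤ _ := by gcongr
  have hroot := Real.rpow_le_rpow (hE0 δ hδI) hfin (one_div_nonneg.2 hq0.le)
  refine hroot.trans_eq ?_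
  have h8 : (8 : ℝ) ^ (2 * q) = 8 ^ D := by rw [← Real.rpow_natCast, hD]; push_cast; rfl
  rw [h8, Real.rpow_mul hδ0.le, hW, ← Real.mul_rpow (by positivity) (by positivity),
    ← Real.mul_rpow (by positivity) (by positivity), ← Real.rpow_mul (by positivity),
    mul_one_div_cancel hq0.ne', Real.rpow_one]

/-- Bernoulli expectation over the random subsets of a finite set `U`. -/
noncomputable def bernExpOn {α : Type*} (U : Finset α) (s : ℝ) (f : Finset α → ℝ) : ℝ :=
  ∑ S ∈ U.powerset, (s ^ S.card * (1 - s) ^ (U.card - S.card)) * f S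

theorem bernExpOn_insert {α : Type*} {U : Finset α} {a : α} (ha : a ∉ U) (s : ℝ)
    (f : Finset α → ℝ) :
    bernExpOn (insert a U) s f =
      s * bernExpOn U s (fun S => f (insert a S)) + (1 - s) * bernExpOn U s f := by
  unfold bernExpOn
  rw [Finset.sum_powerset_insert ha, add_comm, Finset.mul_sum, Finset.mul_sum]
  congr 1
  · refine Finset.sum_congr rfl fun S hS => ?_
    have haS : a ∉ S := fun h => ha (Finset.mem_powerset.1 hS h)
    rw [Finset.card_insert_of_notMem haS, Finset.card_insert_of_notMem ha, Nat.add_sub_add_right]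
    ring
  · refine Finset.sum_congr rfl fun S hS => ?_
    have := Finset.card_le_card (Finset.mem_powerset.1 hS)
    rw [Finset.card_insert_of_notMem ha, Nat.succ_sub this, Nat.succ_eq_add_one, pow_succ]
    ring

theorem bernExpOn_mono {α : Type*} (U : Finset α) {s : ℝ} (hs : s ∈ Set.Icc (0 : ℝ) 1)
    {f g : Finset α → ℝ} (h : ∀ S, f S ≤ g S) : bernExpOn U s f ≤ bernExpOn U s g := by
  have h1 : 0 ≤ 1 - s := sub_nonneg.2 hs.2
  have h0 := hs.1
  exact Finset.sum_le_sum fun S _ => mul_le_mul_of_nonneg_left (h S) (by positivity)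

theorem bernExpOn_le_of_le {α : Type*} (U : Finset α) {s t : ℝ} (hs : 0 ≤ s) (hst : s ≤ t)
    (ht : t ≤ 1) {f : Finset α → ℝ} (hf : Monotone f) : bernExpOn U s f ≤ bernExpOn U t f := by
  induction U using Finset.induction_on generalizing f with
  | empty => simp [bernExpOn]
  | insert a U ha ih =>
    rw [bernExpOn_insert ha, bernExpOn_insert ha]
    have h1 : bernExpOn U s f ≤ bernExpOn U s (fun S => f (insert a S)) :=
      bernExpOn_mono U ⟨hs, hst.trans ht⟩ fun S => hf (Finset.subset_insert a S)
    have h2 := ih hf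
    have h3 := ih (f := fun S => f (insert a S)) fun S T h => hf (Finset.insert_subset_insert a h)
    nlinarith

theorem bernExpOn_subset_indicator {α : Type*} {U T : Finset α} (hT : T ⊆ U) (s : ℝ) :
    bernExpOn U s (fun S => if T ⊆ S then 1 else 0) = s ^ T.card := by
  induction U using Finset.induction_on generalizing T with
  | empty => simp [bernExpOn, Finset.subset_empty.1 hT]
  | insert a U ha ih =>
    rw [bernExpOn_insert ha]
    by_cases haT : a ∈ T
    · have h1 : bernExpOn U s (fun S => if T ⊆ S then (1 : ℝ) else 0) = 0 := by
        refine Finset.sum_eq_zero fun S hS => ?_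
        have hTS : ¬ T ⊆ S := fun h => ha (Finset.mem_powerset.1 hS (h haT))
        simp [hTS]
      have h2 : bernExpOn U s (fun S => if T ⊆ insert a S then (1 : ℝ) else 0) =
          s ^ (T.erase a).card := by
        rw [← ih (T := T.erase a) (Finset.subset_insert_iff.1 hT)]
        simp only [Finset.subset_insert_iff]
      rw [h1, h2, mul_zero, add_zero, ← pow_succ', Finset.card_erase_add_one haT]
    · have hTU : T ⊆ U := (Finset.subset_insert_iff_of_notMem haT).1 hT
      simp only [Finset.subset_insert_iff_of_notMem haT, ih hTU]
      ring

theorem bernExpOn_const {α : Type*} (U : Finset α) (s c : ℝ) :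
    bernExpOn U s (fun _ => c) = c := by
  have h := bernExpOn_subset_indicator (Finset.empty_subset U) s
  simp only [bernExpOn, Finset.empty_subset, if_true, mul_one, Finset.card_empty, pow_zero] at h ⊢
  rw [← Finset.sum_mul, h, one_mul]

theorem bernExpOn_sum {α κ : Type*} (U : Finset α) (s : ℝ) (I : Finset κ)
    (f : κ → Finset α → ℝ) :
    bernExpOn U s (fun S => ∑ i ∈ I, f i S) = ∑ i ∈ I, bernExpOn U s (f i) := by
  simp only [bernExpOn, Finset.mul_sum]
  exact Finset.sum_comm

theorem bernExpOn_const_mul {α : Type*} (U : Finset α) (s c : ℝ) (f : Finset α → ℝ) :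
    bernExpOn U s (fun S => c * f S) = c * bernExpOn U s f := by
  simp only [bernExpOn, Finset.mul_sum]
  exact Finset.sum_congr rfl fun S _ => by ring

theorem bernExpOn_mul_const {α : Type*} (U : Finset α) (s c : ℝ) (f : Finset α → ℝ) :
    bernExpOn U s (fun S => f S * c) = bernExpOn U s f * c := by
  simp only [mul_comm _ c, bernExpOn_const_mul]

theorem bernExp_eq_bernExpOn (n : ℕ) (s : ℝ) (f : Finset (Fin n) → ℝ) :
    bernExp n s f = bernExpOn Finset.univ s f := by
  simp [bernExp, bernExpOn]

theorem bernPairExp_eq_bernExpOn (n : ℕ) (s : ℝ) (f : Finset (Fin n) → Finset (Fin n) → ℝ) :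
    bernPairExp n s f =
      bernExpOn Finset.univ s fun S => bernExpOn Finset.univ s fun S' => f S S' := by
  simp only [bernPairExp, bernExpOn, Finset.mul_sum, Finset.card_univ, Fintype.card_fin]
  exact Finset.sum_congr rfl fun S _ => Finset.sum_congr rfl fun S' _ => by ring

section WalkDegree

/-- The functions of two coordinate sets that are combinations of the monomials
`1[T ⊆ S] 1[T' ⊆ S']` of total degree `|T| + |T'| ≤ d`. -/
noncomputable def setPolySpace (α : Type*) (d : ℕ) :
    Submodule ℂ (Finset α × Finset α → ℂ) :=
  Submodule.span ℂ (Set.range fun (p : {p : Finset α × Finset α // p.1.card + p.2.card ≤ d})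
    (S : Finset α × Finset α) => if p.1.1 ⊆ S.1 ∧ p.1.2 ⊆ S.2 then 1 else 0)

variable {α : Type*}

theorem indicator_mem_setPolySpace {d : ℕ} {T T' : Finset α} (h : T.card + T'.card ≤ d)
    [∀ S : Finset α × Finset α, Decidable (T ⊆ S.1 ∧ T' ⊆ S.2)] :
    (fun S : Finset α × Finset α => if T ⊆ S.1 ∧ T' ⊆ S.2 then (1 : ℂ) else 0) ∈
      setPolySpace α d :=
  Submodule.subset_span ⟨⟨(T, T'), h⟩, by funext S; dsimp only; congr⟩

theorem mul_mem_setPolySpace {d e : ℕ} {f g : Finset α × Finset α → ℂ}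
    (hf : f ∈ setPolySpace α d) (hg : g ∈ setPolySpace α e) : f * g ∈ setPolySpace α (d + e) := by
  have h := Submodule.mul_mem_mul hf hg
  rw [setPolySpace, setPolySpace, Submodule.span_mul_span] at h
  refine Submodule.span_le.2 ?_ h
  rintro _ ⟨_, ⟨⟨p, hp⟩, rfl⟩, _, ⟨⟨r, hr⟩, rfl⟩, rfl⟩
  have hc1 := Finset.card_union_le p.1 r.1
  have hc2 := Finset.card_union_le p.2 r.2
  refine Set.mem_of_eq_of_mem ?_ (indicator_mem_setPolySpace (d := d + e) (T := p.1 ∪ r.1)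
    (T' := p.2 ∪ r.2) (by omega))
  funext S
  simp only [Pi.mul_apply, Finset.union_subset_iff]
  by_cases h1 : p.1 ⊆ S.1 <;> by_cases h2 : p.2 ⊆ S.2 <;> simp [h1, h2]

theorem exists_bernExpOn_eq_eval [Fintype α] {d : ℕ} {g : Finset α × Finset α → ℂ}
    (hg : g ∈ setPolySpace α d) :
    (∃ Q : Polynomial ℝ, Q.natDegree ≤ d ∧ ∀ s : ℝ,
      bernExpOn Finset.univ s (fun S => bernExpOn Finset.univ s fun S' => (g (S, S')).re) =
        Q.eval s) ∧
    ∃ Q : Polynomial ℝ, Q.natDegree ≤ d ∧ ∀ s : ℝ,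
      bernExpOn Finset.univ s (fun S => (g (S, S)).re) = Q.eval s := by
  obtain ⟨c, rfl⟩ := (Submodule.mem_span_range_iff_exists_fun ℂ).1 hg
  have hre : ∀ S S' : Finset α, ((∑ p, c p • fun S : Finset α × Finset α =>
      if p.1.1 ⊆ S.1 ∧ p.1.2 ⊆ S.2 then (1 : ℂ) else 0) (S, S')).re =
      ∑ p, (c p).re * ((if p.1.1 ⊆ S then 1 else 0) * (if p.1.2 ⊆ S' then 1 else 0)) := by
    intro S S'
    rw [Finset.sum_apply, Complex.re_sum]
    refine Finset.sum_congr rfl fun p _ => ?_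
    by_cases h1 : p.1.1 ⊆ S <;> by_cases h2 : p.1.2 ⊆ S' <;> simp [h1, h2]
  simp only [hre]
  constructor
  · refine ⟨∑ p : {p : Finset α × Finset α // p.1.card + p.2.card ≤ d},
      Polynomial.C (c p).re * Polynomial.X ^ (p.1.1.card + p.1.2.card), ?_, fun s => ?_⟩
    · exact Polynomial.natDegree_sum_le_of_forall_le _ _ fun p _ =>
        (Polynomial.natDegree_C_mul_X_pow_le _ _).trans p.2
    · simp only [bernExpOn_sum, bernExpOn_const_mul, Polynomial.eval_finsetSum,
        Polynomial.eval_mul, Polynomial.eval_C, Polynomial.eval_pow, Polynomial.eval_X]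
      refine Finset.sum_congr rfl fun p _ => ?_
      simp only [bernExpOn_subset_indicator (Finset.subset_univ _), bernExpOn_mul_const, pow_add]
  · refine ⟨∑ p : {p : Finset α × Finset α // p.1.card + p.2.card ≤ d},
      Polynomial.C (c p).re * Polynomial.X ^ (p.1.1 ∪ p.1.2).card, ?_, fun s => ?_⟩
    · exact Polynomial.natDegree_sum_le_of_forall_le _ _ fun p _ =>
        (Polynomial.natDegree_C_mul_X_pow_le _ _).trans ((Finset.card_union_le _ _).trans p.2)
    · simp only [bernExpOn_sum, bernExpOn_const_mul, Polynomial.eval_finsetSum,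
        Polynomial.eval_mul, Polynomial.eval_C, Polynomial.eval_pow, Polynomial.eval_X]
      refine Finset.sum_congr rfl fun p _ => ?_
      rw [← bernExpOn_subset_indicator (Finset.subset_univ _)]
      congr 2
      funext S
      by_cases h1 : p.1.1 ⊆ S <;> by_cases h2 : p.1.2 ⊆ S <;>
        simp [h1, h2, Finset.union_subset_iff]

end WalkDegree

section Matrices

open scoped ComplexOrder Matrix Matrix.Norms.L2Operator

theorem one_mem_setPolySpace (α : Type*) : (1 : Finset α × Finset α → ℂ) ∈ setPolySpace α 0 :=
  Set.mem_of_eq_of_mem (by funext S; simp)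
    (indicator_mem_setPolySpace (α := α) (T := ∅) (T' := ∅) le_rfl)

theorem trace_pow_mem_setPolySpace {α ι : Type*} [Fintype ι] [DecidableEq ι] {d : ℕ}
    {X : Finset α × Finset α → Matrix ι ι ℂ}
    (hX : ∀ i k, (fun S => X S i k) ∈ setPolySpace α d) (q : ℕ) :
    (fun S => (X S ^ q).trace) ∈ setPolySpace α (d * q) := by
  have hpow : ∀ i k, (fun S => (X S ^ q) i k) ∈ setPolySpace α (d * q) := by
    induction q with
    | zero =>
      intro i k
      have : (fun S => (X S ^ 0) i k) = (1 : Matrix ι ι ℂ) i k • 1 := by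
        funext S
        rw [pow_zero, Pi.smul_apply, Pi.one_apply, smul_eq_mul, mul_one]
      rw [this]
      exact Submodule.smul_mem _ _ (one_mem_setPolySpace α)
    | succ q ih =>
      intro i k
      have : (fun S => (X S ^ (q + 1)) i k) =
          ∑ j, (fun S => (X S ^ q) i j) * fun S => X S j k := by
        funext S
        rw [pow_succ, Matrix.mul_apply, Finset.sum_apply]
        rfl
      rw [this]
      exact Submodule.sum_mem _ fun j _ => mul_mem_setPolySpace (ih i j) (hX j k)
  have : (fun S => (X S ^ q).trace) = ∑ i, fun S => (X S ^ q) i i := by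
    funext S
    rw [Finset.sum_apply]
    rfl
  rw [this]
  exact Submodule.sum_mem _ fun i _ => hpow i i

theorem trace_compression_pow_mem_setPolySpace {n : ℕ} (A : Matrix (Fin n) (Fin n) ℂ) (q : ℕ) :
    (fun S : Finset (Fin n) × Finset (Fin n) =>
      ((projMatrix S.1 * A * projMatrix S.2 * Aᴴ) ^ q).trace) ∈ setPolySpace (Fin n) (2 * q) := by
  have hX : ∀ i k, (fun S : Finset (Fin n) × Finset (Fin n) =>
      (projMatrix S.1 * A * projMatrix S.2 * Aᴴ) i k) ∈ setPolySpace (Fin n) 2 := by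
    intro i k
    have : (fun S : Finset (Fin n) × Finset (Fin n) =>
        (projMatrix S.1 * A * projMatrix S.2 * Aᴴ) i k) =
        ∑ j, (A i j * Aᴴ j k) • fun S : Finset (Fin n) × Finset (Fin n) =>
          if {i} ⊆ S.1 ∧ {j} ⊆ S.2 then (1 : ℂ) else 0 := by
      funext S
      rw [Matrix.mul_apply, Finset.sum_apply]
      refine Finset.sum_congr rfl fun j _ => ?_
      rw [projMatrix, projMatrix, Matrix.mul_diagonal, Matrix.diagonal_mul]
      by_cases h1 : i ∈ S.1 <;> by_cases h2 : j ∈ S.2 <;> simp [h1, h2]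
    rw [this]
    exact Submodule.sum_mem _ fun j _ => Submodule.smul_mem _ _ <|
      indicator_mem_setPolySpace (by simp)
  exact trace_pow_mem_setPolySpace hX q

theorem projMatrix_mul_of_subset {n : ℕ} {S U : Finset (Fin n)} (h : S ⊆ U) :
    projMatrix S * projMatrix U = projMatrix S := by
  rw [projMatrix, projMatrix, Matrix.diagonal_mul_diagonal]
  congr 1
  funext i
  by_cases h1 : i ∈ S
  · simp [h1, h h1]
  · simp [h1]

theorem projMatrix_mul_of_superset {n : ℕ} {S U : Finset (Fin n)} (h : S ⊆ U) :
    projMatrix U * projMatrix S = projMatrix S := by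
  rw [projMatrix, projMatrix, Matrix.diagonal_mul_diagonal]
  congr 1
  funext i
  by_cases h1 : i ∈ S
  · simp [h1, h h1]
  · simp [h1]

theorem conjTranspose_projMatrix {n : ℕ} (S : Finset (Fin n)) :
    (projMatrix S)ᴴ = projMatrix S := by
  rw [projMatrix, Matrix.diagonal_conjTranspose]
  congr 1
  funext i
  by_cases h1 : i ∈ S <;> simp [h1]

theorem norm_projMatrix_le_one {n : ℕ} (S : Finset (Fin n)) : ‖projMatrix S‖ ≤ 1 := by
  rw [projMatrix, Matrix.l2_opNorm_diagonal, pi_norm_le_iff_of_nonneg zero_le_one]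
  intro i
  by_cases h1 : i ∈ S <;> simp [h1]

theorem norm_projMatrix_mul_mul_le {n : ℕ} (A : Matrix (Fin n) (Fin n) ℂ)
    (S S' : Finset (Fin n)) : ‖projMatrix S * A * projMatrix S'‖ ≤ ‖A‖ := by
  calc _ ≤ ‖projMatrix S‖ * ‖A‖ * ‖projMatrix S'‖ :=
        (norm_mul_le _ _).trans (mul_le_mul_of_nonneg_right (norm_mul_le _ _) (norm_nonneg _))
    _ ≤ 1 * ‖A‖ * 1 := by
        gcongr
        exacts [norm_projMatrix_le_one S, norm_projMatrix_le_one S']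
    _ = ‖A‖ := by ring

theorem norm_projMatrix_mul_mul_mono {n : ℕ} (A : Matrix (Fin n) (Fin n) ℂ)
    {S U S' U' : Finset (Fin n)} (h : S ⊆ U) (h' : S' ⊆ U') :
    ‖projMatrix S * A * projMatrix S'‖ ≤ ‖projMatrix U * A * projMatrix U'‖ := by
  have : projMatrix S * A * projMatrix S' =
      projMatrix S * (projMatrix U * A * projMatrix U') * projMatrix S' := by
    rw [← projMatrix_mul_of_subset h, ← projMatrix_mul_of_superset h']
    simp only [← mul_assoc]
    rw [projMatrix_mul_of_subset h, projMatrix_mul_of_subset h]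
    simp only [mul_assoc]
    rw [projMatrix_mul_of_superset h', projMatrix_mul_of_superset h']
  rw [this]
  exact norm_projMatrix_mul_mul_le _ S S'

theorem trace_compression_pow {n q : ℕ} (hq : 1 ≤ q) (A : Matrix (Fin n) (Fin n) ℂ)
    (S S' : Finset (Fin n)) :
    ((projMatrix S * A * projMatrix S' * (projMatrix S * A * projMatrix S')ᴴ) ^ q).trace =
      ((projMatrix S * A * projMatrix S' * Aᴴ) ^ q).trace := by
  obtain ⟨m, rfl⟩ : ∃ m, q = m + 1 := ⟨q - 1, by omega⟩
  set P := projMatrix S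
  set X := P * A * projMatrix S' * Aᴴ with hX
  have hPP : P * P = P := projMatrix_mul_of_subset (Finset.Subset.refl S)
  have hPX : P * X = X := by
    rw [hX]
    simp only [← mul_assoc]
    rw [hPP]
  have hB : P * A * projMatrix S' * (P * A * projMatrix S')ᴴ = X * P := by
    rw [Matrix.conjTranspose_mul, Matrix.conjTranspose_mul, conjTranspose_projMatrix,
      conjTranspose_projMatrix, hX]
    simp only [← mul_assoc]
    rw [mul_assoc (P * A) (projMatrix S') (projMatrix S'),
      projMatrix_mul_of_subset (Finset.Subset.refl S')]
  have hpow : ∀ m : ℕ, (X * P) ^ (m + 1) = X ^ (m + 1) * P := by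
    intro m
    induction m with
    | zero => simp
    | succ m ih => rw [pow_succ, ih, mul_assoc, ← mul_assoc P X P, hPX, ← mul_assoc, ← pow_succ]
  rw [hB, hpow, Matrix.trace_mul_comm, pow_succ', ← mul_assoc, hPX]

theorem IsSelfAdjoint.norm_pow_le {R : Type*} [NormedRing R] [StarRing R] [CStarRing R]
    {x : R} (hx : IsSelfAdjoint x) {q : ℕ} (hq : 1 ≤ q) : ‖x‖ ^ q ≤ ‖x ^ q‖ := by
  rcases (norm_nonneg x).eq_or_lt with h0 | h0
  · rw [← h0, zero_pow (by omega)]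
    exact norm_nonneg _
  · have hlt : q < 2 ^ q := Nat.lt_two_pow_self
    have h1 : ‖x‖ ^ q * ‖x‖ ^ (2 ^ q - q) ≤ ‖x ^ q‖ * ‖x‖ ^ (2 ^ q - q) := by
      rw [← pow_add, Nat.add_sub_cancel' hlt.le, ← hx.norm_pow_two_pow q]
      calc ‖x ^ 2 ^ q‖ = ‖x ^ q * x ^ (2 ^ q - q)‖ := by
            rw [← pow_add, Nat.add_sub_cancel' hlt.le]
        _ ≤ _ := (norm_mul_le _ _).trans
            (mul_le_mul_of_nonneg_left (norm_pow_le' x (by omega)) (norm_nonneg _))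
    exact le_of_mul_le_mul_right h1 (by positivity)

theorem Matrix.PosSemidef.l2_opNorm_le_re_trace {ι : Type*} [Fintype ι] [DecidableEq ι]
    {M : Matrix ι ι ℂ} (hM : M.PosSemidef) : ‖M‖ ≤ M.trace.re := by
  have htr : M.trace.re = ∑ i, hM.isHermitian.eigenvalues i := by
    rw [hM.isHermitian.trace_eq_sum_eigenvalues]
    simp
  rw [htr]
  have h := hM.isHermitian.spectral_theorem
  have hnorm : ‖M‖ = ‖Matrix.diagonal
      (RCLike.ofReal ∘ hM.isHermitian.eigenvalues : ι → ℂ)‖ := by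
    conv_lhs => rw [h]
    rw [Unitary.conjStarAlgAut_apply, ← Unitary.coe_star, CStarRing.norm_mul_coe_unitary,
      CStarRing.norm_coe_unitary_mul]
  rw [hnorm, Matrix.l2_opNorm_diagonal, pi_norm_le_iff_of_nonneg
    (Finset.sum_nonneg fun i _ => hM.eigenvalues_nonneg i)]
  intro i
  change ‖((hM.isHermitian.eigenvalues i : ℝ) : ℂ)‖ ≤ _
  rw [Complex.norm_real, Real.norm_of_nonneg (hM.eigenvalues_nonneg i)]
  exact Finset.single_le_sum (fun j _ => hM.eigenvalues_nonneg j) (Finset.mem_univ i)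

theorem Matrix.norm_entry_le_l2_opNorm {ι : Type*} [Fintype ι] [DecidableEq ι]
    (M : Matrix ι ι ℂ) (i j : ι) :
    ‖M i j‖ ≤ ‖M‖ := by
  have h := M.l2_opNorm_mulVec (EuclideanSpace.single j 1)
  rw [PiLp.norm_single, norm_one, mul_one] at h
  refine le_trans ?_ ((PiLp.norm_apply_le _ i).trans h)
  simp

theorem norm_pow_le_re_trace {ι : Type*} [Fintype ι] [DecidableEq ι] (B : Matrix ι ι ℂ)
    {q : ℕ} (hq : 1 ≤ q) :
    ‖B‖ ^ (2 * q) ≤ ((B * Bᴴ) ^ q).trace.re := by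
  have hsa : IsSelfAdjoint (B * Bᴴ) := IsSelfAdjoint.mul_star_self B
  have hn : ‖B * Bᴴ‖ = ‖B‖ ^ 2 := by
    rw [sq]; exact CStarRing.norm_self_mul_star
  rw [pow_mul, ← hn]
  exact (hsa.norm_pow_le hq).trans
    ((Matrix.posSemidef_self_mul_conjTranspose B).pow q).l2_opNorm_le_re_trace

theorem re_trace_le_norm_pow {n : ℕ} (B : Matrix (Fin n) (Fin n) ℂ) {q : ℕ} (hq : 1 ≤ q) :
    ((B * Bᴴ) ^ q).trace.re ≤ n * ‖B‖ ^ (2 * q) := by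
  have hn : ‖B * Bᴴ‖ = ‖B‖ ^ 2 := by
    rw [sq]; exact CStarRing.norm_self_mul_star
  have hle : ‖(B * Bᴴ) ^ q‖ ≤ ‖B‖ ^ (2 * q) := by
    rw [pow_mul, ← hn]
    exact norm_pow_le' _ hq
  rw [Matrix.trace, Complex.re_sum]
  calc _ ≤ ∑ _i : Fin n, ‖B‖ ^ (2 * q) := Finset.sum_le_sum fun i _ =>
        (Complex.re_le_norm _).trans ((Matrix.norm_entry_le_l2_opNorm _ i i).trans hle)
    _ = _ := by simp

end Matrices

/-- **Chebyshev extrapolation (Bourgain–Tzafriri).**  Suppose `‖A‖ ≤ 1`, `q` is an integer with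
`13 log n ≤ q ≤ n/2`, `ϱ ∈ (0,1)`, `δ ∈ [ϱ,1]`, and `λ ∈ [0,1]`.  Then
`(E ‖R_δ A R'_δ‖^{2q})^{1/(2q)} ≤ 8 δ^λ max{1, ϱ^{−λ} (E ‖R_ϱ A R'_ϱ‖^{2q})^{1/(2q)}}`,
and the same bound holds with the same projector on both sides. -/
theorem stmt_16 (n : ℕ) (A : Matrix (Fin n) (Fin n) ℂ) (hA : specNorm A ≤ 1)
    (q : ℕ) (hq1 : 13 * Real.log n ≤ q) (hq2 : (q : ℝ) ≤ n / 2)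
    (ϱ δ : ℝ) (hϱ0 : 0 < ϱ) (hϱ1 : ϱ < 1) (hδϱ : ϱ ≤ δ) (hδ1 : δ ≤ 1)
    (lam : ℝ) (hlam0 : 0 ≤ lam) (hlam1 : lam ≤ 1) :
    (bernPairExp n δ
            fun S S' => specNorm (projMatrix S * A * projMatrix S') ^ (2 * q)) ^
          ((1 : ℝ) / (2 * q)) ≤
        8 * δ ^ lam * max 1 (ϱ ^ (-lam) *
          (bernPairExp n ϱ
              fun S S' => specNorm (projMatrix S * A * projMatrix S') ^ (2 * q)) ^
            ((1 : ℝ) / (2 * q))) ∧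
      (bernExp n δ fun S => specNorm (projMatrix S * A * projMatrix S) ^ (2 * q)) ^
          ((1 : ℝ) / (2 * q)) ≤
        8 * δ ^ lam * max 1 (ϱ ^ (-lam) *
          (bernExp n ϱ fun S => specNorm (projMatrix S * A * projMatrix S) ^ (2 * q)) ^
            ((1 : ℝ) / (2 * q))) := by
  rcases Nat.lt_or_ge q 1 with hq0 | hq
  · obtain rfl : q = 0 := by omega
    have hδ0 : 0 < δ := hϱ0.trans_le hδϱ
    have h1 : 1 ≤ δ ^ lam * ϱ ^ (-lam) := by
      rw [Real.rpow_neg hϱ0.le, ← div_eq_mul_inv, one_le_div (Real.rpow_pos_of_pos hϱ0 _)]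
      exact Real.rpow_le_rpow hϱ0.le hδϱ hlam0
    have h2 : 1 ≤ 8 * δ ^ lam * max 1 (ϱ ^ (-lam)) := by
      have h3 : δ ^ lam * ϱ ^ (-lam) ≤ δ ^ lam * max 1 (ϱ ^ (-lam)) :=
        mul_le_mul_of_nonneg_left (le_max_right _ _) (Real.rpow_nonneg hδ0.le _)
      linarith
    simpa using h2
  have hn : 1 ≤ n := by
    rcases Nat.eq_zero_or_pos n with rfl | h
    · have : (1 : ℝ) ≤ q := by exact_mod_cast hq
      norm_num at hq2
      omega
    · exact h
  simp only [bernPairExp_eq_bernExpOn, bernExp_eq_bernExpOn]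
  obtain ⟨⟨Q, hQd, hQ⟩, Q', hQd', hQ'⟩ :=
    exists_bernExpOn_eq_eval (trace_compression_pow_mem_setPolySpace A q)
  have hlow : ∀ S S', specNorm (projMatrix S * A * projMatrix S') ^ (2 * q) ≤
      ((projMatrix S * A * projMatrix S' * A.conjTranspose) ^ q).trace.re := fun S S' => by
    rw [← trace_compression_pow hq]
    exact norm_pow_le_re_trace (projMatrix S * A * projMatrix S') hq
  have hupp : ∀ S S', ((projMatrix S * A * projMatrix S' * A.conjTranspose) ^ q).trace.re ≤
      n * specNorm (projMatrix S * A * projMatrix S') ^ (2 * q) := fun S S' => by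
    rw [← trace_compression_pow hq]
    exact re_trace_le_norm_pow (projMatrix S * A * projMatrix S') hq
  have hnn : ∀ S S', 0 ≤ specNorm (projMatrix S * A * projMatrix S') ^ (2 * q) := fun S S' =>
    pow_nonneg (norm_nonneg _) _
  have hle1 : ∀ S S', specNorm (projMatrix S * A * projMatrix S') ^ (2 * q) ≤ 1 := fun S S' =>
    pow_le_one₀ (norm_nonneg _) ((norm_projMatrix_mul_mul_le A S S').trans hA)
  have hmono : ∀ {S U S' U' : Finset (Fin n)}, S ⊆ U → S' ⊆ U' →
      specNorm (projMatrix S * A * projMatrix S') ^ (2 * q) ≤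
        specNorm (projMatrix U * A * projMatrix U') ^ (2 * q) := fun h h' =>
    pow_le_pow_left₀ (norm_nonneg _) (norm_projMatrix_mul_mul_mono A h h') _
  constructor
  · refine extrapolation_of_polynomial_bounds (E := fun s => bernExpOn Finset.univ s fun S =>
      bernExpOn Finset.univ s fun S' => specNorm (projMatrix S * A * projMatrix S') ^ (2 * q))
      hn hq hq1 hϱ0 hϱ1 hδϱ hδ1 hQd ?_ ?_ ?_ ?_ ?_
    · intro s hs
      rw [← hQ]
      exact bernExpOn_mono _ hs fun S => bernExpOn_mono _ hs fun S' => hlow S S'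
    · intro s hs
      rw [← hQ, ← bernExpOn_const_mul]
      refine bernExpOn_mono _ hs fun S => ?_
      rw [← bernExpOn_const_mul]
      exact bernExpOn_mono _ hs fun S' => hupp S S'
    · intro s hs t ht hst
      refine (bernExpOn_mono _ hs fun S => bernExpOn_le_of_le _ hs.1 hst ht.2 ?_).trans
        (bernExpOn_le_of_le _ hs.1 hst ht.2 ?_)
      · exact fun S' U' h => hmono (Finset.Subset.refl S) h
      · exact fun S U h => bernExpOn_mono _ ht fun S' => hmono h (Finset.Subset.refl S')
    · intro s hs
      rw [← bernExpOn_const (Finset.univ : Finset (Fin n)) s 0]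
      refine bernExpOn_mono _ hs fun S => ?_
      rw [← bernExpOn_const (Finset.univ : Finset (Fin n)) s 0]
      exact bernExpOn_mono _ hs fun S' => hnn S S'
    · intro s hs
      rw [← bernExpOn_const (Finset.univ : Finset (Fin n)) s 1]
      refine bernExpOn_mono _ hs fun S => ?_
      rw [← bernExpOn_const (Finset.univ : Finset (Fin n)) s 1]
      exact bernExpOn_mono _ hs fun S' => hle1 S S'
  · refine extrapolation_of_polynomial_bounds (E := fun s => bernExpOn Finset.univ s fun S =>
      specNorm (projMatrix S * A * projMatrix S) ^ (2 * q))
      hn hq hq1 hϱ0 hϱ1 hδϱ hδ1 hQd' ?_ ?_ ?_ ?_ ?_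
    · intro s hs
      rw [← hQ']
      exact bernExpOn_mono _ hs fun S => hlow S S
    · intro s hs
      rw [← hQ', ← bernExpOn_const_mul]
      exact bernExpOn_mono _ hs fun S => hupp S S
    · exact fun s hs t ht hst => bernExpOn_le_of_le _ hs.1 hst ht.2 fun S U h => hmono h h
    · intro s hs
      rw [← bernExpOn_const (Finset.univ : Finset (Fin n)) s 0]
      exact bernExpOn_mono _ hs fun S => hnn S S
    · intro s hs
      rw [← bernExpOn_const (Finset.univ : Finset (Fin n)) s 1]
      exact bernExpOn_mono _ hs fun S => hle1 S S
end

section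
/- (V. A. Markov coefficient bound) Let p(t) = Σ_{k=0}^{r} c_k t^k be a polynomial of degree at most r with real (or complex) coefficients. Then for each k = 0, 1, …, r, |c_k| ≤ (r^k / k!) · max_{|t| ≤ 1} |p(t)| ≤ e^r · max_{|t| ≤ 1} |p(t)|. -/
open Polynomial Finset

theorem zero_lt_prod_sub_of_strictAntiOn {n i : ℕ} {y : ℕ → ℝ}
    (hy : StrictAntiOn y (range (n + 1))) (hi : i ≤ n) :
    0 < (-1) ^ i * ∏ j ∈ (range (n + 1)).erase i, (y i - y j) := by
  have hlt {a b : ℕ} (hb : b ≤ n) (hab : a < b) : y b < y a :=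
    hy (by simp; lia) (by simp; lia) hab
  have h₁ : 0 < ∏ j ∈ range i, ((-1) * (y i - y j)) :=
    prod_pos fun j hj => mul_pos_of_neg_of_neg neg_one_lt_zero <| sub_neg.mpr <|
      hlt hi (mem_range.mp hj)
  rw [prod_mul_distrib, prod_const, card_range] at h₁
  have h₂ : 0 < ∏ j ∈ Ioc i n, (y i - y j) :=
    prod_pos fun j hj => sub_pos.mpr <| hlt (mem_Ioc.mp hj).2 (mem_Ioc.mp hj).1
  have union : (range (n + 1)).erase i = range i ∪ Ioc i n := by grind
  have disjoint : Disjoint (range i) (Ioc i n) := by grind [disjoint_iff_ne]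
  rw [union, prod_union disjoint, ← mul_assoc]
  exact mul_pos h₁ h₂

/-- If `F` dominates `E` with alternating signs on `n + 1` nonnegative nodes, then the coefficients
of `F` dominate those of `E`. -/
theorem abs_coeff_le_of_alternating {n k : ℕ} (hk : k ≤ n) {y : ℕ → ℝ}
    (hy : StrictAntiOn y (range (n + 1))) (hy0 : ∀ i ≤ n, 0 ≤ y i) {E F : ℝ[X]}
    (hE : E.degree < (n + 1 : ℕ)) (hF : F.degree < (n + 1 : ℕ))
    (hEF : ∀ i ≤ n, |E.eval (y i)| ≤ (-1) ^ i * F.eval (y i)) :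
    |E.coeff k| ≤ |F.coeff k| := by
  set w : ℕ → ℝ := fun i => ((-1) ^ i * ∏ j ∈ (range (n + 1)).erase i, (y i - y j))⁻¹ *
    ∑ t ∈ ((range (n + 1)).erase i).powersetCard (n - k), ∏ a ∈ t, y a with hw
  have hw0 : ∀ i ≤ n, 0 ≤ w i := fun i hi =>
    mul_nonneg (inv_nonneg.mpr (zero_lt_prod_sub_of_strictAntiOn hy hi).le) <|
      sum_nonneg fun t ht => prod_nonneg fun a ha => hy0 a <| by
        have := mem_of_mem_erase ((mem_powersetCard.mp ht).1 ha)
        simpa [Nat.lt_succ_iff] using this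
  have key {P : ℝ[X]} (hP : P.degree < (n + 1 : ℕ)) :
      P.coeff k = (-1) ^ (n - k) * ∑ i ∈ range (n + 1), (-1) ^ i * P.eval (y i) * w i := by
    have h := Lagrange.eval_iterate_derivative_eq_sum hy.injOn (P := P) (by simpa using hP)
      (k := k) (by simp; lia) 0
    rw [← coeff_zero_eq_eval_zero, coeff_iterate_derivative] at h
    simp only [zero_add, Nat.descFactorial_self, nsmul_eq_mul] at h
    rw [mul_left_cancel₀ (Nat.cast_ne_zero.mpr k.factorial_ne_zero) h, mul_sum]
    refine sum_congr rfl fun i _ => ?_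
    have hs : ∑ t ∈ ((range (n + 1)).erase i).powersetCard (n - k), ∏ a ∈ t, (0 - y a) =
        (-1) ^ (n - k) *
          ∑ t ∈ ((range (n + 1)).erase i).powersetCard (n - k), ∏ a ∈ t, y a := by
      rw [mul_sum]
      refine sum_congr rfl fun t ht => ?_
      simp_rw [zero_sub, prod_neg, (mem_powersetCard.mp ht).2]
    have hsq : ((-1 : ℝ) ^ i) * ((-1) ^ i)⁻¹ = 1 := mul_inv_cancel₀ (by simp)
    rw [card_range, Nat.add_sub_add_right, hs, hw]
    simp only [mul_inv, div_eq_mul_inv]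
    linear_combination (-1) * (eval (y i) P *
      (∏ j ∈ (range (n + 1)).erase i, (y i - y j))⁻¹ * ((-1) ^ (n - k) *
      ∑ t ∈ ((range (n + 1)).erase i).powersetCard (n - k), ∏ a ∈ t, y a)) * hsq
  rw [key hE, key hF, abs_mul, abs_mul]
  refine mul_le_mul_of_nonneg_left ?_ (abs_nonneg _)
  refine le_trans (le_trans (abs_sum_le_sum_abs _ _) (sum_le_sum fun i hi => ?_)) (le_abs_self _)
  have hi' : i ≤ n := by simpa [Nat.lt_succ_iff] using hi
  rw [abs_mul, abs_mul, abs_neg_one_pow, one_mul, abs_of_nonneg (hw0 i hi')]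
  exact mul_le_mul_of_nonneg_right (hEF i hi') (hw0 i hi')

/-- The polynomial `∑ j ≤ n, p_{2j+ε} X ^ j` collecting the coefficients of `p` at indices of the
parity of `ε`. -/
noncomputable def parityPart (n ε : ℕ) (p : ℝ[X]) : ℝ[X] :=
  ∑ j ∈ range (n + 1), C (p.coeff (2 * j + ε)) * X ^ j

theorem degree_parityPart_lt (n ε : ℕ) (p : ℝ[X]) :
    (parityPart n ε p).degree < (n + 1 : ℕ) := by
  refine (degree_sum_le _ _).trans_lt <| (Finset.sup_lt_iff (by simp)).mpr fun j hj => ?_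
  exact (degree_C_mul_X_pow_le _ _).trans_lt (by exact_mod_cast mem_range.mp hj)

theorem coeff_parityPart {n ε j : ℕ} (hj : j ≤ n) (p : ℝ[X]) :
    (parityPart n ε p).coeff j = p.coeff (2 * j + ε) := by
  simp only [parityPart, finsetSum_coeff, coeff_C_mul, coeff_X_pow, mul_ite, mul_one, mul_zero]
  rw [sum_ite_eq, if_pos (by simp; lia)]

theorem two_mul_pow_mul_eval_parityPart {n ε : ℕ} (hε : ε < 2) {p : ℝ[X]}
    (hp : p.natDegree < 2 * (n + 1) + ε) (x : ℝ) :
    2 * (x ^ ε * (parityPart n ε p).eval (x ^ 2)) = p.eval x + (-1) ^ ε * p.eval (-x) := by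
  have key (c : ℕ → ℝ) (N : ℕ) : 2 * ∑ j ∈ range N, x ^ ε * (c (2 * j + ε) * (x ^ 2) ^ j) =
      ∑ i ∈ range (2 * N + ε), c i * x ^ i +
        (-1) ^ ε * ∑ i ∈ range (2 * N + ε), c i * (-x) ^ i := by
    induction N with
    | zero => interval_cases ε <;> simp
    | succ N ih =>
      rw [show 2 * (N + 1) + ε = 2 * N + ε + 1 + 1 by ring, sum_range_succ, mul_add, ih]
      simp only [sum_range_succ]
      have h : (-x) ^ (2 * N) = x ^ (2 * N) := (even_two_mul N).neg_pow x
      interval_cases ε <;> simp only [pow_add, h, pow_mul] <;> ring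
  rw [eval_eq_sum_range' hp, eval_eq_sum_range' hp, ← key, parityPart, eval_finsetSum, mul_sum]
  simp

theorem abs_coeff_le_mul_abs_coeff_T {m k : ℕ} (hk : k ≤ m) (hkm : k % 2 = m % 2) {p : ℝ[X]}
    (hp : p.natDegree ≤ m + 1) {M : ℝ} (hM : ∀ x ∈ Set.Icc (-1 : ℝ) 1, |p.eval x| ≤ M) :
    |p.coeff k| ≤ M * |(Chebyshev.T ℝ m).coeff k| := by
  have hM0 : 0 ≤ M := (abs_nonneg _).trans (hM 0 (by simp))
  obtain ⟨n, ε, hε, rfl⟩ : ∃ n ε, ε < 2 ∧ m = 2 * n + ε := ⟨m / 2, m % 2, by lia, by lia⟩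
  obtain ⟨j, hj, rfl⟩ : ∃ j ≤ n, k = 2 * j + ε := ⟨k / 2, by lia, by lia⟩
  set m := 2 * n + ε with hm
  have hpos {i : ℕ} (hi : i ≤ n) (hε1 : ε = 1 ∨ i < n) : 0 < Chebyshev.node m i := by
    have hmR : (2 * i : ℝ) < m := by exact_mod_cast (show 2 * i < m by lia)
    have hm0 : (0 : ℝ) < m := lt_of_le_of_lt (by positivity) hmR
    refine Real.cos_pos_of_mem_Ioo ⟨?_, ?_⟩
    · have : 0 ≤ i * Real.pi / m := by positivity
      linarith [Real.pi_pos]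
    · rw [div_lt_iff₀ hm0]
      nlinarith [Real.pi_pos]
  have hnonneg {i : ℕ} (hi : i ≤ n) : 0 ≤ Chebyshev.node m i := by
    rcases Nat.eq_zero_or_pos m with h0 | h0
    · simp [Chebyshev.node, h0]
    have hmR : (2 * i : ℝ) ≤ m := by exact_mod_cast (show 2 * i ≤ m by lia)
    have hm0 : (0 : ℝ) < m := by exact_mod_cast h0
    refine Real.cos_nonneg_of_mem_Icc ⟨?_, ?_⟩
    · have : 0 ≤ i * Real.pi / m := by positivity
      linarith [Real.pi_pos]
    · rw [div_le_iff₀ hm0]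
      nlinarith [Real.pi_pos]
  have hy : StrictAntiOn (fun i => Chebyshev.node m i ^ 2) (range (n + 1)) := by
    intro a _ b hb hab
    have hb' : b ≤ n := by simpa [Nat.lt_succ_iff] using hb
    exact pow_lt_pow_left₀ (Chebyshev.node_lt (by lia) hab) (hnonneg hb') two_ne_zero
  have h := abs_coeff_le_of_alternating hj hy (fun i _ => sq_nonneg _)
    (degree_parityPart_lt n ε p) (degree_parityPart_lt n ε (C M * Chebyshev.T ℝ m)) ?_
  · rwa [coeff_parityPart hj, coeff_parityPart hj, coeff_C_mul, abs_mul, abs_of_nonneg hM0] at h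
  intro i hi
  set x := Chebyshev.node m i with hx
  have hxmem : x ∈ Set.Icc (-1 : ℝ) 1 := Chebyshev.node_mem_Icc
  have hE := two_mul_pow_mul_eval_parityPart (n := n) hε (p := p) (by lia) x
  have hF := two_mul_pow_mul_eval_parityPart (n := n) hε (p := C M * Chebyshev.T ℝ m)
    ((natDegree_C_mul_le _ _).trans_lt (by rw [Chebyshev.natDegree_T]; simp; lia)) x
  have hTx : (Chebyshev.T ℝ m).eval x = (-1) ^ i :=
    Chebyshev.eval_T_real_node (by simp; lia)
  have hTx' : (Chebyshev.T ℝ m).eval (-x) = (-1) ^ ε * (-1) ^ i := by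
    rw [Chebyshev.T_eval_neg, hTx, hm]
    congr 1
    interval_cases ε <;> simp [Int.negOnePow_add, Int.negOnePow_even]
  rw [eval_mul, eval_mul, eval_C, eval_C, hTx, hTx'] at hF
  have hxε : 0 < x ^ ε := by
    interval_cases ε
    · simp
    · simpa using hpos hi (Or.inl rfl)
  refine le_of_mul_le_mul_left ?_ hxε
  have h₁ : x ^ ε * ((-1) ^ i * (parityPart n ε (C M * Chebyshev.T ℝ m)).eval (x ^ 2)) = M := by
    have hi2 : ((-1 : ℝ) ^ i) * (-1) ^ i = 1 := by simp [← mul_pow]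
    have hε2 : ((-1 : ℝ) ^ ε) * (-1) ^ ε = 1 := by simp [← mul_pow]
    linear_combination (-1) ^ i / 2 * hF + M * hi2 + M / 2 * ((-1) ^ i * (-1) ^ i) * hε2
  rw [h₁, ← abs_of_pos hxε, ← abs_mul,
    show x ^ ε * (parityPart n ε p).eval (x ^ 2) = (p.eval x + (-1) ^ ε * p.eval (-x)) / 2 by
      linarith, abs_div, abs_two, div_le_iff₀ two_pos]
  refine (abs_add_le _ _).trans ?_
  rw [abs_mul, abs_neg_one_pow, one_mul]
  linarith [hM x hxmem, hM (-x) (by grind)]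

theorem abs_eval_iterate_derivative_T_zero_le {m : ℕ} :
    ∀ {k : ℕ}, k ≤ m → |(derivative^[k] (Chebyshev.T ℝ m)).eval 0| ≤ (m : ℝ) ^ k
  | 0, _ => by simpa using Chebyshev.abs_eval_T_real_le_one m (x := 0) (by simp)
  | 1, _ => by
    simp only [Function.iterate_one, Chebyshev.T_derivative_eq_U, eval_mul, pow_one]
    rw [Chebyshev.U_eval_zero, abs_mul]
    refine (mul_le_mul_of_nonneg_left (b := _) (c := 1) ?_ (abs_nonneg _)).trans ?_
    · split_ifs
      · rcases Int.even_or_odd (((m : ℤ) - 1) / 2) with h | h <;>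
          simp [Int.negOnePow_even, Int.negOnePow_odd, h]
      · simp
    · simp
  | k + 2, hk => by
    have hkm : (k : ℝ) ≤ m := by exact_mod_cast (by lia : k ≤ m)
    rw [Chebyshev.iterate_derivative_T_eval_zero_recurrence, abs_mul, abs_neg, pow_add, mul_comm]
    gcongr
    · exact abs_eval_iterate_derivative_T_zero_le (by lia)
    · rw [Int.cast_natCast, abs_of_nonneg (by nlinarith [Nat.cast_nonneg (α := ℝ) k])]
      nlinarith [Nat.cast_nonneg (α := ℝ) k]

theorem abs_coeff_T_le {m k : ℕ} (hk : k ≤ m) :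
    |(Chebyshev.T ℝ m).coeff k| ≤ (m : ℝ) ^ k / k.factorial := by
  have h := abs_eval_iterate_derivative_T_zero_le hk
  rw [← coeff_zero_eq_eval_zero, coeff_iterate_derivative] at h
  simp only [zero_add, Nat.descFactorial_self, nsmul_eq_mul, abs_mul, Nat.abs_cast] at h
  rwa [le_div_iff₀ (by positivity), mul_comm]

/-- **V. A. Markov's coefficient bound** for real polynomials. -/
theorem abs_coeff_le_of_forall_abs_le {r k : ℕ} (hk : k ≤ r) {p : ℝ[X]} (hp : p.natDegree ≤ r)
    {M : ℝ} (hM : ∀ x ∈ Set.Icc (-1 : ℝ) 1, |p.eval x| ≤ M) :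
    |p.coeff k| ≤ (r : ℝ) ^ k / k.factorial * M := by
  have hM0 : 0 ≤ M := (abs_nonneg _).trans (hM 0 (by simp))
  obtain ⟨m, hkm, hmr, hrm, hpar⟩ : ∃ m, k ≤ m ∧ m ≤ r ∧ r ≤ m + 1 ∧ k % 2 = m % 2 := by
    by_cases h : k % 2 = r % 2
    · exact ⟨r, hk, le_rfl, by lia, h⟩
    · exact ⟨r - 1, by lia, by lia, by lia, by lia⟩
  calc |p.coeff k| ≤ M * |(Chebyshev.T ℝ m).coeff k| :=
        abs_coeff_le_mul_abs_coeff_T hkm hpar (hp.trans hrm) hM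
    _ ≤ M * ((m : ℝ) ^ k / k.factorial) := by gcongr; exact abs_coeff_T_le hkm
    _ ≤ M * ((r : ℝ) ^ k / k.factorial) := by gcongr
    _ = _ := mul_comm _ _

/-- **V. A. Markov coefficient bound.**  If `p(t) = Σ_{k=0}^r c_k t^k`, then for each `k ≤ r`,
`|c_k| ≤ (r^k / k!) · max_{|t| ≤ 1} |p(t)| ≤ e^r · max_{|t| ≤ 1} |p(t)|`. -/
theorem stmt_19 (r : ℕ) (c : ℕ → ℝ) (k : ℕ) (hk : k ≤ r) :
    |c k| ≤ ((r : ℝ) ^ k / (Nat.factorial k : ℝ)) *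
        sSup ((fun t => |∑ i ∈ Finset.range (r + 1), c i * t ^ i|) '' Set.Icc (-1 : ℝ) 1) ∧
      |c k| ≤ Real.exp r *
        sSup ((fun t => |∑ i ∈ Finset.range (r + 1), c i * t ^ i|) '' Set.Icc (-1 : ℝ) 1) := by
  set S := (fun t => |∑ i ∈ Finset.range (r + 1), c i * t ^ i|) '' Set.Icc (-1 : ℝ) 1 with hS
  have hbdd : BddAbove S :=
    isCompact_Icc.bddAbove_image (Continuous.continuousOn (by fun_prop))
  have hle : ∀ x ∈ Set.Icc (-1 : ℝ) 1, |∑ i ∈ range (r + 1), c i * x ^ i| ≤ sSup S :=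
    fun x hx => le_csSup hbdd ⟨x, hx, rfl⟩
  have h₁ : |c k| ≤ (r : ℝ) ^ k / k.factorial * sSup S := by
    have h := abs_coeff_le_of_forall_abs_le (p := ∑ i ∈ range (r + 1), C (c i) * X ^ i) hk
      (natDegree_sum_le_of_forall_le _ _ fun i hi =>
        (natDegree_C_mul_X_pow_le _ _).trans (by simpa [Nat.lt_succ_iff] using hi))
      (M := sSup S) (fun x hx => by simpa [eval_finsetSum] using hle x hx)
    simpa [coeff_X_pow, Nat.lt_succ_iff, hk] using h
  refine ⟨h₁, h₁.trans ?_⟩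
  have hS0 : 0 ≤ sSup S := (abs_nonneg _).trans (hle 0 (by simp))
  gcongr
  exact Real.pow_div_factorial_le_exp _ (Nat.cast_nonneg r) k
end
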